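/- arXiv:1508.02962 — 2 statements merged into one kernel-verified Lean document; each statement's English description precedes it below -/
import Mathlib

section
/- Let F be a cone subequation on ℝⁿ with dual F̃, and let h be a downward-pointing singular F-harmonic of finite type at a point x₀ ∈ ℝⁿ. Let v and w be upper semicontinuous [−∞,∞)-valued functions on a neighborhood of x₀, with v F-subharmonic and w F̃-subharmonic on the deleted neighborhood, and assume liminf_{x→x₀} (v(x) − v(x₀))/(h(x) − h(x₀)) ≥ 1 and liminf_{x→x₀} (w(x) − w(x₀))/(h(x) − h(x₀)) ≥ −1. Then the function u = v + w, redefined at x₀ by u(x₀) = limsup_{x→x₀} u(x), is subaffine on a neighborhood of x₀. -/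
open scoped Topology Classical
open Filter

noncomputable section

/-- Euclidean space ℝⁿ. -/
abbrev EucSp (n : ℕ) := EuclideanSpace ℝ (Fin n)

/-- The space Sym²(ℝⁿ) of symmetric real n×n matrices, with its subspace topology. -/
abbrev SymMat (n : ℕ) := selfAdjoint (Matrix (Fin n) (Fin n) ℝ)

variable {n : ℕ}

/-- The matrix of the orthogonal projection onto the line ℝ·e (for a unit vector e). -/
def projMat (e : EucSp n) : Matrix (Fin n) (Fin n) ℝ := Matrix.of fun i j => e i * e j

lemma projMat_selfAdjoint (e : EucSp n) :
    projMat e ∈ selfAdjoint (Matrix (Fin n) (Fin n) ℝ) := by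
  rw [selfAdjoint.mem_iff]
  ext i j
  simp [projMat, Matrix.star_apply, mul_comm]

/-- P_e, the projection onto ℝ·e, as an element of Sym²(ℝⁿ). -/
def symProj (e : EucSp n) : SymMat n := ⟨projMat e, projMat_selfAdjoint e⟩

/-- The matrix P_{e⊥} − (p−1)·P_e. -/
def charMatM (p : ℝ) (e : EucSp n) : Matrix (Fin n) (Fin n) ℝ :=
  (1 - projMat e) - (p - 1) • projMat e

lemma charMatM_selfAdjoint (p : ℝ) (e : EucSp n) :
    charMatM p e ∈ selfAdjoint (Matrix (Fin n) (Fin n) ℝ) := by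
  have h := projMat_selfAdjoint e
  rw [selfAdjoint.mem_iff] at h ⊢
  simp [charMatM, star_sub, star_smul, star_one, h]

/-- P_{e⊥} − (p−1)·P_e as an element of Sym²(ℝⁿ). -/
def charMat (p : ℝ) (e : EucSp n) : SymMat n := ⟨charMatM p e, charMatM_selfAdjoint p e⟩

/-- A (constant coefficient, pure second order) cone subequation on ℝⁿ: a nonempty,
closed, proper subset of Sym²(ℝⁿ) satisfying positivity (F1) and the cone property (F2). -/
structure ConeSubequation (n : ℕ) where
  carrier : Set (SymMat n)
  nonempty' : carrier.Nonempty
  proper' : carrier ≠ Set.univ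
  isClosed' : IsClosed carrier
  f1 : ∀ A ∈ carrier, ∀ P : SymMat n, (P : Matrix (Fin n) (Fin n) ℝ).PosSemidef → A + P ∈ carrier
  f2 : ∀ A ∈ carrier, ∀ t : ℝ, 0 < t → t • A ∈ carrier

/-- The dual of a set of symmetric matrices: F̃ = {A : −A ∉ Int F}. -/
def dualSet (S : Set (SymMat n)) : Set (SymMat n) := {A | -A ∉ interior S}

/-- The subequation P = {A ≥ 0} of positive semidefinite matrices. -/
def PosP (n : ℕ) : Set (SymMat n) := {A | (A : Matrix (Fin n) (Fin n) ℝ).PosSemidef}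

/-- The Hessian matrix (D²f)(x) of a real function on ℝⁿ. -/
def hessMatrix (f : EucSp n → ℝ) (x : EucSp n) : Matrix (Fin n) (Fin n) ℝ :=
  Matrix.of fun i j =>
    iteratedFDeriv ℝ 2 f x ![EuclideanSpace.single i 1, EuclideanSpace.single j 1]

/-- ψ is a test function for u at x₀ (relative to the set X): ψ is C² near x₀,
u ≤ ψ near x₀ (within X), and u(x₀) = ψ(x₀). -/
def IsTestAt (X : Set (EucSp n)) (u : EucSp n → EReal) (ψ : EucSp n → ℝ) (x₀ : EucSp n) :
    Prop :=
  ContDiffAt ℝ 2 ψ x₀ ∧ (∀ᶠ x in 𝓝[X] x₀, u x ≤ (ψ x : EReal)) ∧ u x₀ = (ψ x₀ : EReal)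

/-- u admits no test functions at x₀ (relative to X). -/
def NoTestAt (X : Set (EucSp n)) (u : EucSp n → EReal) (x₀ : EucSp n) : Prop :=
  ∀ ψ : EucSp n → ℝ, ¬ IsTestAt X u ψ x₀

/-- u is S-subharmonic on X (viscosity sense): u is upper semicontinuous on X with values
in [−∞,∞), and for every test function ψ for u at a point of X, the Hessian of ψ there
lies in S. -/
def FSubharmonicOn (S : Set (SymMat n)) (X : Set (EucSp n)) (u : EucSp n → EReal) : Prop :=
  UpperSemicontinuousOn u X ∧ (∀ x ∈ X, u x ≠ ⊤) ∧
    ∀ x₀ ∈ X, ∀ ψ : EucSp n → ℝ, IsTestAt X u ψ x₀ →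
      hessMatrix ψ x₀ ∈ Subtype.val '' S

/-- u is F-harmonic on X: u is F-subharmonic and −u is F̃-subharmonic on X. -/
def FHarmonicOn (F : ConeSubequation n) (X : Set (EucSp n)) (u : EucSp n → EReal) : Prop :=
  FSubharmonicOn F.carrier X u ∧ FSubharmonicOn (dualSet F.carrier) X (fun x => -u x)

/-- u is subaffine on X, i.e. P̃-subharmonic on X. -/
def SubaffineOn (X : Set (EucSp n)) (u : EucSp n → EReal) : Prop :=
  FSubharmonicOn (dualSet (PosP n)) X u

/-- h is a downward-pointing singular F-harmonic at x₀ on the neighborhood U: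
continuous, F-subharmonic on U, F-harmonic on U∖{x₀}, with a strict minimum at x₀, and
either of polar type (h(x₀) = −∞) or of finite type (h(x₀) > −∞, no test functions at x₀). -/
structure DPSingular (F : ConeSubequation n) (U : Set (EucSp n)) (x₀ : EucSp n)
    (h : EucSp n → EReal) : Prop where
  isOpen' : IsOpen U
  mem : x₀ ∈ U
  cont : ContinuousOn h U
  subh : FSubharmonicOn F.carrier U h
  harm : FHarmonicOn F (U \ {x₀}) h
  strictMin : ∀ x ∈ U, x ≠ x₀ → h x₀ < h x
  polarOrFinite : h x₀ = ⊥ ∨ (h x₀ ≠ ⊥ ∧ NoTestAt U h x₀)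

/-- Polar-case asymptotic equivalence H ≈ h at x₀: h − C ≤ H ≤ h + C near x₀. -/
def PolarAsymp (H : EucSp n → ℝ) (h : EucSp n → EReal) (x₀ : EucSp n) : Prop :=
  ∃ C : ℝ, ∀ᶠ x in 𝓝[≠] x₀, h x - (C : EReal) ≤ (H x : EReal) ∧ (H x : EReal) ≤ h x + (C : EReal)

/-- Finite-case asymptotic equivalence H ∼ h at x₀:
lim_{x→x₀} (H(x) − H(x₀))/(h(x) − h(x₀)) = 1. -/
def FiniteAsymp (H : EucSp n → ℝ) (h : EucSp n → EReal) (x₀ : EucSp n) : Prop :=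
  Tendsto (fun x => (H x - H x₀) / ((h x).toReal - (h x₀).toReal)) (𝓝[≠] x₀) (𝓝 1)

/-- Ω is a bounded domain: open, connected and bounded. -/
def IsBoundedDomain (Ω : Set (EucSp n)) : Prop :=
  IsOpen Ω ∧ IsConnected Ω ∧ Bornology.IsBounded Ω

/-- Condition (F3): −P_e ∉ F for every unit vector e. -/
def CondF3 (F : ConeSubequation n) : Prop :=
  ∀ e : EucSp n, ‖e‖ = 1 → -(symProj e) ∉ F.carrier

/-- The inward unit normal −∇ρ(x)/|∇ρ(x)| of the hypersurface {ρ = 0} bounding {ρ < 0}. -/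
def innerNormal (ρ : EucSp n → ℝ) (x : EucSp n) : EucSp n :=
  -(‖gradient ρ x‖⁻¹ • gradient ρ x)

/-- The second fundamental form of {ρ = 0} at x with respect to the inward normal,
extended by zero on the normal line: the tangential part of Hess ρ(x)/|∇ρ(x)|. -/
def secondFF (ρ : EucSp n → ℝ) (x : EucSp n) : Matrix (Fin n) (Fin n) ℝ :=
  ‖gradient ρ x‖⁻¹ •
    ((1 - projMat (innerNormal ρ x)) * hessMatrix ρ x * (1 - projMat (innerNormal ρ x)))

/-- Ω has smooth boundary which is strictly F-convex: Ω is globally defined by a smooth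
defining function ρ with nonvanishing gradient along ∂Ω, and at every boundary point
II_x + t·P_{ν(x)} ∈ Int F for all sufficiently large t. -/
def StrictlyConvexBoundary (F : ConeSubequation n) (Ω : Set (EucSp n)) : Prop :=
  ∃ ρ : EucSp n → ℝ, ContDiff ℝ (⊤ : ℕ∞) ρ ∧ Ω = {x | ρ x < 0} ∧
    ∀ x ∈ frontier Ω, gradient ρ x ≠ 0 ∧
      ∃ t₀ : ℝ, ∀ t ≥ t₀,
        secondFF ρ x + t • projMat (innerNormal ρ x) ∈ Subtype.val '' interior F.carrier

/-- F is invariant under O(n): gᵀ A g ∈ F for every orthogonal g and A ∈ F. -/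
def OrthInvariant (F : ConeSubequation n) : Prop :=
  ∀ g : Matrix (Fin n) (Fin n) ℝ, g.transpose * g = 1 →
    ∀ A ∈ F.carrier, ∀ B : SymMat n,
      (B : Matrix (Fin n) (Fin n) ℝ) = g.transpose * (A : Matrix (Fin n) (Fin n) ℝ) * g →
      B ∈ F.carrier

/-- F has Riesz characteristic p: P_{e⊥} − (p−1)P_e ∈ ∂F for every unit vector e. -/
def HasRieszChar (F : ConeSubequation n) (p : ℝ) : Prop :=
  ∀ e : EucSp n, ‖e‖ = 1 → charMat p e ∈ frontier F.carrier

/-- The Riesz kernel K_p. -/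
def rieszKernel (p : ℝ) (x : EucSp n) : ℝ :=
  if p = 2 then Real.log ‖x‖ else -(p - 2)⁻¹ * ‖x‖ ^ (2 - p)

/-- A function on `[0, 1]` whose increments are at most quadratic is nonincreasing. -/
lemma le_of_sub_le_mul_sq {ψ : ℝ → ℝ} {C : ℝ}
    (hψ : ∀ a b, 0 ≤ a → a ≤ b → b ≤ 1 → ψ b - ψ a ≤ C * (b - a) ^ 2) : ψ 1 ≤ ψ 0 := by
  have key : ∀ N : ℕ, ψ 1 - ψ 0 ≤ C * (1 / ((N : ℝ) + 1)) := by
    intro N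
    have hN : (0 : ℝ) < (N : ℝ) + 1 := by positivity
    have hsum := Finset.sum_range_sub (fun i : ℕ => ψ ((i : ℝ) / ((N : ℝ) + 1))) (N + 1)
    have hle : ∑ i ∈ Finset.range (N + 1), (ψ (((i + 1 : ℕ) : ℝ) / ((N : ℝ) + 1)) -
        ψ ((i : ℝ) / ((N : ℝ) + 1))) ≤
        ∑ _i ∈ Finset.range (N + 1), C * (1 / ((N : ℝ) + 1)) ^ 2 := by
      refine Finset.sum_le_sum fun i hi => ?_
      have hi' : ((i : ℝ) + 1) ≤ (N : ℝ) + 1 := by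
        exact_mod_cast Finset.mem_range.1 hi
      have := hψ ((i : ℝ) / ((N : ℝ) + 1)) (((i + 1 : ℕ) : ℝ) / ((N : ℝ) + 1)) (by positivity)
        (by gcongr; linarith) (by rw [div_le_one hN]; push_cast; exact hi')
      refine this.trans (le_of_eq ?_)
      congr 2
      push_cast
      ring
    rw [hsum] at hle
    simp only [Nat.cast_add, Nat.cast_one, div_self hN.ne', Nat.cast_zero, zero_div,
      Finset.sum_const, Finset.card_range, nsmul_eq_mul] at hle
    refine hle.trans (le_of_eq ?_)
    field_simp
  have hlim : Tendsto (fun N : ℕ => C * (1 / ((N : ℝ) + 1))) atTop (𝓝 (C * 0)) :=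
    tendsto_one_div_add_atTop_nhds_zero_nat.const_mul C
  have := ge_of_tendsto' hlim key
  linarith

section Convex

variable {E : Type*} [NormedAddCommGroup E] [InnerProductSpace ℝ E]

open scoped RealInnerProductSpace

/-- Second-order Taylor expansion of a function at a point of differentiability of a selection of
its subgradients. -/
lemma eventually_abs_taylor_le_of_hasFDerivAt_subgradient {f : E → ℝ} {P : E → E}
    (hP : ∀ x y, f x + ⟪P x, y - x⟫ ≤ f y) {A : E →L[ℝ] E} {x : E} (hA : HasFDerivAt P A x)
    {η : ℝ} (hη : 0 < η) :
    ∀ᶠ h in 𝓝 (0 : E), |f (x + h) - f x - ⟪P x, h⟫ - ⟪A h, h⟫ / 2| ≤ η * ‖h‖ ^ 2 := by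
  have h1 := (hasFDerivAt_iff_isLittleO_nhds_zero.1 hA).def hη
  obtain ⟨r, hr, hball⟩ := Metric.eventually_nhds_iff_ball.1 h1
  filter_upwards [Metric.ball_mem_nhds (0 : E) hr] with h hh
  have hin : ∀ t : ℝ, 0 ≤ t → t ≤ 1 →
      |⟪P (x + t • h), h⟫ - ⟪P x, h⟫ - t * ⟪A h, h⟫| ≤ η * ‖h‖ ^ 2 := by
    intro t ht0 ht1
    have hth : ‖t • h‖ ≤ ‖h‖ := by
      rw [norm_smul, Real.norm_of_nonneg ht0]
      exact mul_le_of_le_one_left (norm_nonneg _) ht1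
    have h2 := hball (t • h) (by
      rw [mem_ball_zero_iff] at hh ⊢
      exact hth.trans_lt hh)
    have h3 : ⟪P (x + t • h), h⟫ - ⟪P x, h⟫ - t * ⟪A h, h⟫ =
        ⟪P (x + t • h) - P x - A (t • h), h⟫ := by
      simp only [inner_sub_left, map_smul, inner_smul_left]
      simp
    rw [h3]
    calc _ ≤ ‖P (x + t • h) - P x - A (t • h)‖ * ‖h‖ := abs_real_inner_le_norm _ _
      _ ≤ (η * ‖h‖) * ‖h‖ := by
        gcongr
        exact h2.trans (by gcongr)
      _ = _ := by ring
  have hsub : ∀ a b : ℝ, f (x + a • h) + (b - a) * ⟪P (x + a • h), h⟫ ≤ f (x + b • h) := by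
    intro a b
    have := hP (x + a • h) (x + b • h)
    rwa [show x + b • h - (x + a • h) = (b - a) • h by module, inner_smul_right] at this
  have up := le_of_sub_le_mul_sq (C := ⟪A h, h⟫ / 2)
    (ψ := fun t => f (x + t • h) - t * ⟪P x, h⟫ - t ^ 2 / 2 * ⟪A h, h⟫ - t * (η * ‖h‖ ^ 2)) (by
      intro a b ha hab hb
      have h1 := hsub b a
      have h2 := (abs_le.1 (hin b (ha.trans hab) hb)).2
      have h3 := mul_le_mul_of_nonneg_left h2 (sub_nonneg.2 hab)
      linear_combination h1 + h3)
  have low := le_of_sub_le_mul_sq (C := ⟪A h, h⟫ / 2)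
    (ψ := fun t => -f (x + t • h) + t * ⟪P x, h⟫ + t ^ 2 / 2 * ⟪A h, h⟫ - t * (η * ‖h‖ ^ 2)) (by
      intro a b ha hab hb
      have h1 := hsub a b
      have h2 := (abs_le.1 (hin a ha (hab.trans hb))).1
      have h3 := mul_le_mul_of_nonneg_left h2 (sub_nonneg.2 hab)
      linear_combination h1 + h3)
  simp only [one_smul, zero_smul, add_zero] at up low
  rw [abs_le]
  constructor <;> linarith

/-- At a point where a function is touched from above by a paraboloid, any selection of
its subgradients is Lipschitz. -/
lemma norm_subgradient_sub_le {f : E → ℝ} {P : E → E}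
    (hP : ∀ x y, f x + ⟪P x, y - x⟫ ≤ f y) {R c : ℝ} {x : E} (hc : 0 ≤ c)
    (hx : ∀ y, ‖y‖ ≤ R → f y ≤ f x + ⟪P x, y - x⟫ + c * ‖y - x‖ ^ 2) {y : E}
    (hy : ‖y‖ + ‖y - x‖ ≤ R) : ‖P y - P x‖ ≤ 4 * c * ‖y - x‖ := by
  rcases eq_or_ne (P y - P x) 0 with hD | hD
  · rw [hD, norm_zero]; positivity
  rcases eq_or_ne y x with rfl | hyx
  · simp
  set D := P y - P x with hDdef
  have hDn : 0 < ‖D‖ := norm_pos_iff.2 hD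
  have hr : 0 < ‖y - x‖ := norm_pos_iff.2 (sub_ne_zero.2 hyx)
  set e := (‖y - x‖ / ‖D‖) • D with he
  have hen : ‖e‖ = ‖y - x‖ := by
    rw [he, norm_smul, Real.norm_of_nonneg (by positivity)]
    field_simp
  have h1 := hP y (y + e)
  have h2 := hP x y
  have h3 := hx (y + e) ((norm_add_le _ _).trans (by rw [hen]; exact hy))
  have h4 : ‖y + e - x‖ ≤ 2 * ‖y - x‖ := by
    rw [show y + e - x = (y - x) + e by abel]
    exact (norm_add_le _ _).trans (by rw [hen]; linarith)
  have h5 : ⟪D, e⟫ = ‖y - x‖ * ‖D‖ := by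
    rw [he, inner_smul_right, real_inner_self_eq_norm_sq]
    field_simp
  have h6 : ⟪D, e⟫ = ⟪P y, y + e - y⟫ + ⟪P x, y - x⟫ - ⟪P x, y + e - x⟫ := by
    simp only [hDdef, inner_sub_left, inner_sub_right, inner_add_right]
    ring
  have h7 : c * ‖y + e - x‖ ^ 2 ≤ c * (2 * ‖y - x‖) ^ 2 := by gcongr
  have h8 : ‖y - x‖ * ‖D‖ ≤ ‖y - x‖ * (4 * c * ‖y - x‖) := by
    rw [← h5, h6]
    linarith
  exact le_of_mul_le_mul_left h8 hr


open MeasureTheory in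
/-- If `P` is controlled by its values on `K`, agrees with a Lipschitz map on `K`, and both that map
and the distance to `K` are differentiable at a point of `K`, then so is `P`. -/
lemma hasFDerivAt_of_differentiableAt_infDist {P G : E → E} {K : Set E} {C ρ : ℝ}
    (hC : 0 < C) (hG : ∀ y z, ‖G y - G z‖ ≤ C * ‖y - z‖) (hPG : Set.EqOn P G K)
    (hPK : ∀ z ∈ K, ∀ y, ‖y‖ < ρ → ‖P y - P z‖ ≤ C * ‖y - z‖) {x : E} (hx : x ∈ K)
    (hxρ : ‖x‖ < ρ) (hGx : DifferentiableAt ℝ G x)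
    (hKx : DifferentiableAt ℝ (fun y => Metric.infDist y K) x) :
    HasFDerivAt P (fderiv ℝ G x) x := by
  have h0 : Metric.infDist x K = 0 := Metric.infDist_zero_of_mem hx
  have hmin : IsLocalMin (fun y => Metric.infDist y K) x :=
    Eventually.of_forall fun y => by
      simp only [h0]
      exact Metric.infDist_nonneg
  have hD := hKx.hasFDerivAt
  rw [hmin.hasFDerivAt_eq_zero hD] at hD
  have hlo := hD.isLittleO
  simp only [h0, sub_zero, zero_apply] at hlo
  have hdiff : (fun y => P y - G y) =O[𝓝 x] fun y => Metric.infDist y K := by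
    refine Asymptotics.IsBigO.of_bound (2 * C) ?_
    filter_upwards [(isOpen_lt continuous_norm continuous_const).mem_nhds hxρ] with y hy
    rw [Real.norm_of_nonneg Metric.infDist_nonneg]
    have : ‖P y - G y‖ / (2 * C) ≤ Metric.infDist y K := by
      refine (Metric.le_infDist ⟨x, hx⟩).2 fun z hz => ?_
      rw [div_le_iff₀ (by positivity), dist_eq_norm]
      have h1 := hPK z hz y hy
      have h2 := hG z y
      have h3 : P y - G y = (P y - P z) + (G z - G y) := by rw [hPG hz]; abel
      rw [h3]
      refine (norm_add_le _ _).trans ?_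
      rw [norm_sub_rev z y] at h2
      linarith
    rwa [div_le_iff₀ (by positivity), mul_comm] at this
  have hsum := (hdiff.trans_isLittleO hlo).add hGx.hasFDerivAt.isLittleO
  refine HasFDerivAt.of_isLittleO (hsum.congr_left fun y => ?_)
  rw [hPG hx]
  abel

open MeasureTheory Module in
/-- The Jensen–Alexandrov lemma for a pair of functions with everywhere defined subgradients: if
`f + g` is touched from above by paraboloids with all sufficiently small slopes, then at some such
contact point the two subgradient maps are differentiable. -/
lemma exists_contact_hasFDerivAt [FiniteDimensional ℝ E] {f g : E → ℝ} {P Q : E → E}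
    (hP : ∀ x y, f x + ⟪P x, y - x⟫ ≤ f y) (hQ : ∀ x y, g x + ⟪Q x, y - x⟫ ≤ g y)
    {c R δ : ℝ} (hc : 0 < c) (hR : 0 < R) (hδ : 0 < δ)
    (hK : ∀ s : E, ‖s‖ ≤ δ → ∃ x, ‖x‖ ≤ R / 5 ∧ ∀ y, ‖y‖ ≤ R →
      f y + g y - c * ‖y‖ ^ 2 - ⟪s, y⟫ ≤ f x + g x - c * ‖x‖ ^ 2 - ⟪s, x⟫) :
    ∃ (x s : E) (A B : E →L[ℝ] E), ‖s‖ ≤ δ ∧ ‖x‖ ≤ R / 5 ∧ (∀ y, ‖y‖ ≤ R →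
      f y + g y - c * ‖y‖ ^ 2 - ⟪s, y⟫ ≤ f x + g x - c * ‖x‖ ^ 2 - ⟪s, x⟫) ∧
      HasFDerivAt P A x ∧ HasFDerivAt Q B x ∧
      ∀ h, ⟪A h, h⟫ + ⟪B h, h⟫ ≤ 2 * c * ‖h‖ ^ 2 := by
  set K : Set E := {x | ‖x‖ ≤ R / 5 ∧ ∃ s : E, ‖s‖ ≤ δ ∧ ∀ y, ‖y‖ ≤ R →
      f y + g y - c * ‖y‖ ^ 2 - ⟪s, y⟫ ≤ f x + g x - c * ‖x‖ ^ 2 - ⟪s, x⟫} with hKdef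
  have hsq : ∀ x y : E, ‖y‖ ^ 2 = ‖x‖ ^ 2 + 2 * ⟪x, y - x⟫ + ‖y - x‖ ^ 2 := by
    intro x y
    have := norm_add_sq_real x (y - x)
    rwa [add_sub_cancel] at this
  have hslope : ∀ x s : E, ‖x‖ ≤ R / 5 → (∀ y, ‖y‖ ≤ R →
      f y + g y - c * ‖y‖ ^ 2 - ⟪s, y⟫ ≤ f x + g x - c * ‖x‖ ^ 2 - ⟪s, x⟫) →
      P x + Q x - (2 * c) • x = s := by
    intro x s hx hs
    by_contra hne
    set d := P x + Q x - (2 * c) • x - s with hd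
    have hd0 : d ≠ 0 := sub_ne_zero.2 hne
    have hdn : 0 < ‖d‖ := norm_pos_iff.2 hd0
    set t := min (1 / (c + 1)) (R / (2 * ‖d‖)) with ht
    have ht0 : 0 < t := by positivity
    have ht1 : t * (c + 1) ≤ 1 := by
      rw [← le_div_iff₀ (by positivity)]; exact min_le_left _ _
    have ht2 : t * (2 * ‖d‖) ≤ R := by
      rw [← le_div_iff₀ (by positivity)]; exact min_le_right _ _
    have htd : ‖t • d‖ = t * ‖d‖ := by rw [norm_smul, Real.norm_of_nonneg ht0.le]
    have h1 := hs (x + t • d) ((norm_add_le _ _).trans (by rw [htd]; linarith))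
    have h2 := hP x (x + t • d)
    have h3 := hQ x (x + t • d)
    have h4 := hsq x (x + t • d)
    rw [add_sub_cancel_left, htd] at h4
    rw [add_sub_cancel_left] at h2 h3
    have h5 : ⟪P x, t • d⟫ + ⟪Q x, t • d⟫ - 2 * c * ⟪x, t • d⟫ - ⟪s, t • d⟫ = t * ‖d‖ ^ 2 := by
      have h50 : ∀ e, ⟪d, e⟫ = ⟪P x, e⟫ + ⟪Q x, e⟫ - 2 * c * ⟪x, e⟫ - ⟪s, e⟫ := fun e => by
        simp only [hd, inner_sub_left, inner_add_left, inner_smul_left, RCLike.conj_to_real]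
      rw [← real_inner_self_eq_norm_sq d, ← inner_smul_right d d t, h50]
    rw [inner_add_right s] at h1
    have h6 : t * ‖d‖ ^ 2 ≤ c * (t * ‖d‖) ^ 2 := by
      rw [h4] at h1
      linarith
    have h7 : t * ‖d‖ ^ 2 * (1 - t * c) ≤ 0 := by linarith
    have h8 : 0 < t * ‖d‖ ^ 2 * (1 - t * c) := by
      have : 0 < 1 - t * c := by linarith
      positivity
    linarith
  have hfup : ∀ x ∈ K, (∀ y, ‖y‖ ≤ R → f y ≤ f x + ⟪P x, y - x⟫ + c * ‖y - x‖ ^ 2) ∧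
      (∀ y, ‖y‖ ≤ R → g y ≤ g x + ⟪Q x, y - x⟫ + c * ‖y - x‖ ^ 2) := by
    rintro x ⟨hx, s, -, hs⟩
    have hsl := hslope x s hx hs
    have key : ∀ y, ‖y‖ ≤ R →
        f y + g y ≤ f x + g x + ⟪P x, y - x⟫ + ⟪Q x, y - x⟫ + c * ‖y - x‖ ^ 2 := by
      intro y hy
      have h1 := hs y hy
      have h2 := hsq x y
      have h3 : ⟪s, y - x⟫ = ⟪P x, y - x⟫ + ⟪Q x, y - x⟫ - 2 * c * ⟪x, y - x⟫ := by
        rw [← hsl]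
        simp only [inner_sub_left, inner_add_left, inner_smul_left, RCLike.conj_to_real]
      rw [inner_sub_right s] at h3
      rw [h2] at h1
      linarith
    exact ⟨fun y hy => by linarith [key y hy, hQ x y], fun y hy => by linarith [key y hy, hP x y]⟩
  have hPK : ∀ z ∈ K, ∀ y, ‖y‖ < 2 * R / 5 → ‖P y - P z‖ ≤ 4 * c * ‖y - z‖ := fun z hz y hy =>
    norm_subgradient_sub_le hP hc.le (hfup z hz).1 (by
      have := norm_sub_le y z
      linarith [hz.1])
  have hQK : ∀ z ∈ K, ∀ y, ‖y‖ < 2 * R / 5 → ‖Q y - Q z‖ ≤ 4 * c * ‖y - z‖ := fun z hz y hy =>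
    norm_subgradient_sub_le hQ hc.le (hfup z hz).2 (by
      have := norm_sub_le y z
      linarith [hz.1])
  have hKR : ∀ z ∈ K, ‖z‖ < 2 * R / 5 := fun z hz => by linarith [hz.1]
  have hPL : LipschitzOnWith (4 * c).toNNReal P K :=
    LipschitzOnWith.of_dist_le_mul fun y hy z hz => by
      rw [Real.coe_toNNReal _ (by positivity), dist_eq_norm, dist_eq_norm]
      exact hPK z hz y (hKR y hy)
  have hQL : LipschitzOnWith (4 * c).toNNReal Q K :=
    LipschitzOnWith.of_dist_le_mul fun y hy z hz => by
      rw [Real.coe_toNNReal _ (by positivity), dist_eq_norm, dist_eq_norm]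
      exact hQK z hz y (hKR y hy)
  obtain ⟨G, hGL, hPG⟩ := hPL.extend_finite_dimension
  obtain ⟨H, hHL, hQH⟩ := hQL.extend_finite_dimension
  set L := lipschitzExtensionConstant E * (4 * c).toNNReal with hL
  borelize E
  obtain ⟨x, hxK, hGx, hHx, hdx⟩ : ∃ x ∈ K, DifferentiableAt ℝ G x ∧ DifferentiableAt ℝ H x ∧
      DifferentiableAt ℝ (fun y => Metric.infDist y K) x := by
    by_contra hcon
    push Not at hcon
    set N : Set E := {x | ¬ (DifferentiableAt ℝ G x ∧ DifferentiableAt ℝ H x ∧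
      DifferentiableAt ℝ (fun y => Metric.infDist y K) x)} with hN
    have hN0 : (μH[finrank ℝ E] : Measure E) N = 0 := by
      have h1 := hGL.ae_differentiableAt (μ := (μH[finrank ℝ E] : Measure E))
      have h2 := hHL.ae_differentiableAt (μ := (μH[finrank ℝ E] : Measure E))
      have h3 := (Metric.lipschitz_infDist_pt K).ae_differentiableAt
        (μ := (μH[finrank ℝ E] : Measure E))
      exact ae_iff.1 (h1.and (h2.and h3))
    have hSL := (hGL.add hHL).sub (lipschitzWith_smul (α := ℝ) (β := E) (2 * c))
    have himg := hSL.hausdorffMeasure_image_le (d := finrank ℝ E) (by positivity) N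
    rw [hN0, mul_zero] at himg
    have hsub : Metric.closedBall (0 : E) δ ⊆ (fun x => G x + H x - (2 * c) • x) '' N := by
      intro s hs
      rw [mem_closedBall_zero_iff] at hs
      obtain ⟨x, hx, hxs⟩ := hK s hs
      have hxK : x ∈ K := ⟨hx, s, hs, hxs⟩
      refine ⟨x, fun hx => hcon x hxK hx.1 hx.2.1 hx.2.2, ?_⟩
      simp only
      rw [← hPG hxK, ← hQH hxK]
      exact hslope x s hx hxs
    have hpos := Metric.measure_closedBall_pos (μH[finrank ℝ E] : Measure E) (0 : E) hδ
    exact absurd (measure_mono hsub |>.trans himg) (not_le.2 hpos)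
  set C : ℝ := L + 4 * c with hCdef
  have hC : 0 < C := by positivity
  have hC1 : (L : ℝ) ≤ C := by rw [hCdef]; linarith
  have hC2 : 4 * c ≤ C := by rw [hCdef]; linarith [L.coe_nonneg]
  have hA := hasFDerivAt_of_differentiableAt_infDist hC
    (fun y z => by
      have := hGL.dist_le_mul y z
      rw [dist_eq_norm, dist_eq_norm] at this
      exact this.trans (by gcongr)) hPG
    (fun z hz y hy => (hPK z hz y hy).trans (by gcongr)) hxK (hKR x hxK) hGx hdx
  have hB := hasFDerivAt_of_differentiableAt_infDist hC
    (fun y z => by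
      have := hHL.dist_le_mul y z
      rw [dist_eq_norm, dist_eq_norm] at this
      exact this.trans (by gcongr)) hQH
    (fun z hz y hy => (hQK z hz y hy).trans (by gcongr)) hxK (hKR x hxK) hHx hdx
  obtain ⟨hxR, s, hsδ, hs⟩ := id hxK
  refine ⟨x, s, _, _, hsδ, hxR, hs, hA, hB, fun h => ?_⟩
  refine le_of_forall_pos_le_add fun ζ hζ => ?_
  set η := ζ / (4 * (‖h‖ ^ 2 + 1)) with hη
  have hη0 : 0 < η := by positivity
  have e1 := eventually_abs_taylor_le_of_hasFDerivAt_subgradient hP hA hη0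
  have e2 := eventually_abs_taylor_le_of_hasFDerivAt_subgradient hQ hB hη0
  have e3 : ∀ᶠ y in 𝓝 (0 : E), ‖y‖ < R / 5 :=
    (isOpen_lt continuous_norm continuous_const).mem_nhds (by simpa using hR)
  have htend : Tendsto (fun t : ℝ => t • h) (𝓝[>] 0) (𝓝 0) := by
    have : Tendsto (fun t : ℝ => t • h) (𝓝 0) (𝓝 ((0 : ℝ) • h)) :=
      (continuous_id.smul continuous_const).tendsto 0
    rw [zero_smul] at this
    exact this.mono_left nhdsWithin_le_nhds
  obtain ⟨t, ⟨⟨ht1, ht2⟩, ht3⟩, ht0⟩ :=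
    ((htend.eventually ((e1.and e2).and e3)).and self_mem_nhdsWithin).exists
  have ht0 : 0 < t := ht0
  have hxt : ‖x + t • h‖ ≤ R := (norm_add_le _ _).trans (by linarith)
  have h1 := (abs_le.1 ht1).1
  have h2 := (abs_le.1 ht2).1
  have h3 := hs _ hxt
  have h4 := hsq x (x + t • h)
  have h5 := hslope x s hxR hs
  rw [add_sub_cancel_left] at h4
  have h6 : ⟪s, t • h⟫ = ⟪P x, t • h⟫ + ⟪Q x, t • h⟫ - 2 * c * ⟪x, t • h⟫ := by
    rw [← h5]
    simp only [inner_sub_left, inner_add_left, inner_smul_left, RCLike.conj_to_real]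
  rw [h4, inner_add_right s] at h3
  have h7 : ‖t • h‖ ^ 2 = t ^ 2 * ‖h‖ ^ 2 := by rw [norm_smul, mul_pow, Real.norm_eq_abs, sq_abs]
  have h8 : ∀ D : E →L[ℝ] E, ⟪D (t • h), t • h⟫ = t ^ 2 * ⟪D h, h⟫ := fun D => by
    rw [map_smul, inner_smul_left, inner_smul_right, RCLike.conj_to_real]; ring
  rw [h8, h7] at h1 h2
  rw [h7] at h3
  have h9 : t ^ 2 * (⟪fderiv ℝ G x h, h⟫ + ⟪fderiv ℝ H x h, h⟫) ≤
      t ^ 2 * (2 * c * ‖h‖ ^ 2 + 4 * η * ‖h‖ ^ 2) := by linarith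
  have h10 := le_of_mul_le_mul_left h9 (by positivity)
  have h11 : 4 * η * ‖h‖ ^ 2 ≤ ζ := by
    rw [hη]
    have : 4 * (ζ / (4 * (‖h‖ ^ 2 + 1))) * ‖h‖ ^ 2 = ζ * (‖h‖ ^ 2 / (‖h‖ ^ 2 + 1)) := by
      field_simp
    rw [this]
    refine mul_le_of_le_one_right hζ.le ?_
    rw [div_le_one (by positivity)]
    linarith
  linarith

/-- The sup-convolution of an upper semicontinuous function on a ball, made convex by adding a
multiple of the squared norm, together with the selection of maximizers giving its subgradients. -/
lemma exists_supConvolution [FiniteDimensional ℝ E] {v : E → ℝ} {R : ℝ} (hR : 0 ≤ R) (c : ℝ)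
    (hv : UpperSemicontinuousOn v (Metric.closedBall 0 R)) :
    ∃ (f : E → ℝ) (Z : E → E), (∀ x, ‖Z x‖ ≤ R) ∧ (∀ x y, f x + ⟪c • Z x, y - x⟫ ≤ f y) ∧
      (∀ x z, ‖z‖ ≤ R → v z - c / 2 * ‖x - z‖ ^ 2 + c / 2 * ‖x‖ ^ 2 ≤ f x) ∧
      ∀ x, f x = v (Z x) - c / 2 * ‖x - Z x‖ ^ 2 + c / 2 * ‖x‖ ^ 2 := by
  have hex : ∀ x : E, ∃ z, ‖z‖ ≤ R ∧ ∀ z', ‖z'‖ ≤ R →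
      v z' - c / 2 * ‖x - z'‖ ^ 2 ≤ v z - c / 2 * ‖x - z‖ ^ 2 := by
    intro x
    have hcont : Continuous fun z : E => -(c / 2 * ‖x - z‖ ^ 2) := by fun_prop
    obtain ⟨z, hz, hmax⟩ := (hv.add (hcont.continuousOn.upperSemicontinuousOn)).exists_isMaxOn
      ⟨0, by simpa using hR⟩ (isCompact_closedBall (0 : E) R)
    refine ⟨z, by simpa using hz, fun z' hz' => ?_⟩
    have := hmax (show z' ∈ Metric.closedBall (0 : E) R by simpa using hz')
    simpa [sub_eq_add_neg] using this
  choose Z hZ hmax using hex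
  refine ⟨fun x => v (Z x) - c / 2 * ‖x - Z x‖ ^ 2 + c / 2 * ‖x‖ ^ 2, Z, hZ, fun x y => ?_,
    fun x z hz => by linarith [hmax x z hz], fun x => rfl⟩
  have h1 := hmax y (Z x) (hZ x)
  have h2 := norm_sub_sq_real x (Z x)
  have h3 := norm_sub_sq_real y (Z x)
  simp only [inner_smul_left, inner_sub_right, RCLike.conj_to_real]
  rw [real_inner_comm] at h2 h3
  rw [h3] at h1
  rw [h2]
  linarith

/-- A second-order expansion of the sup-convolution at a point gives a paraboloid touching the
original function from above at the corresponding maximizer. -/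
lemma eventually_le_of_supConvolution {v f : E → ℝ} {Z : E → E} {c R : ℝ}
    (hsub : ∀ x y, f x + ⟪c • Z x, y - x⟫ ≤ f y)
    (hle : ∀ x z, ‖z‖ ≤ R → v z - c / 2 * ‖x - z‖ ^ 2 + c / 2 * ‖x‖ ^ 2 ≤ f x)
    (heq : ∀ x, f x = v (Z x) - c / 2 * ‖x - Z x‖ ^ 2 + c / 2 * ‖x‖ ^ 2)
    {x : E} (hx : ‖Z x‖ < R) {A : E →L[ℝ] E} (hA : HasFDerivAt (fun y => c • Z y) A x)
    {ζ : ℝ} (hζ : 0 < ζ) :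
    ∀ᶠ h in 𝓝 (0 : E), v (Z x + h) ≤ v (Z x) + ⟪c • Z x - c • x, h⟫ +
      ⟪((1 / 2 : ℝ) • A + (ζ - c / 2) • ContinuousLinearMap.id ℝ E) h, h⟫ := by
  have e1 := eventually_abs_taylor_le_of_hasFDerivAt_subgradient hsub hA hζ
  have e2 : ∀ᶠ h in 𝓝 (0 : E), ‖Z x + h‖ < R :=
    (isOpen_lt (by fun_prop) continuous_const).mem_nhds (by simpa using hx)
  filter_upwards [e1, e2] with h h1 h2
  have h3 := hle (x + h) (Z x + h) h2.le
  have h4 := heq x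
  have h5 := (abs_le.1 h1).2
  have h6 := norm_add_sq_real x h
  rw [add_sub_add_right_eq_sub] at h3
  rw [h6] at h3
  simp only [inner_sub_left, inner_smul_left, RCLike.conj_to_real, inner_add_left,
    add_apply, smul_apply, ContinuousLinearMap.id_apply,
    real_inner_self_eq_norm_sq] at h5 ⊢
  linarith

/-- Localization of almost-maximal pairs near a strict maximum. -/
lemma exists_pos_forall_almost_max [FiniteDimensional ℝ E] {v w : E → ℝ} {c R η : ℝ}
    (hc : 0 < c) (hη : 0 < η)
    (hv : UpperSemicontinuousOn v (Metric.closedBall 0 R))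
    (hw : UpperSemicontinuousOn w (Metric.closedBall 0 R)) (hv0 : v 0 = 0) (hw0 : w 0 = 0)
    (hvw : ∀ x, ‖x‖ ≤ R → v x + w x ≤ -c * ‖x‖ ^ 2) :
    ∃ θ > 0, ∀ z t, ‖z‖ ≤ R → ‖t‖ ≤ R → ‖z - t‖ ≤ θ → -θ ≤ v z + w t →
      ‖z‖ < η ∧ ‖t‖ < η ∧ -η < v z ∧ -η < w t := by
  by_contra! hcon
  choose z t hz ht hzt hval hbad using fun k : ℕ =>
    hcon (1 / ((k : ℝ) + 1)) (by positivity)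
  obtain ⟨a, ha, φ, hφ, hza⟩ := (isCompact_closedBall (0 : E) R).tendsto_subseq
    (fun k => by simpa using hz k)
  have hθ : Tendsto (fun k => 1 / ((φ k : ℝ) + 1)) atTop (𝓝 0) :=
    tendsto_one_div_add_atTop_nhds_zero_nat.comp hφ.tendsto_atTop
  have hta : Tendsto (t ∘ φ) atTop (𝓝 a) := by
    have h1 : Tendsto (fun k => z (φ k) - t (φ k)) atTop (𝓝 0) :=
      squeeze_zero_norm (fun k => hzt (φ k)) hθ
    have h2 := hza.sub h1
    simpa [Function.comp_def] using h2
  have hzW : Tendsto (z ∘ φ) atTop (𝓝[Metric.closedBall 0 R] a) :=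
    tendsto_nhdsWithin_iff.2 ⟨hza, Eventually.of_forall fun k => by simpa using hz (φ k)⟩
  have htW : Tendsto (t ∘ φ) atTop (𝓝[Metric.closedBall 0 R] a) :=
    tendsto_nhdsWithin_iff.2 ⟨hta, Eventually.of_forall fun k => by simpa using ht (φ k)⟩
  have hva : ∀ ε > 0, ∀ᶠ k in atTop, v (z (φ k)) < v a + ε := fun ε hε =>
    hzW.eventually (hv a ha (v a + ε) (by linarith))
  have hwa : ∀ ε > 0, ∀ᶠ k in atTop, w (t (φ k)) < w a + ε := fun ε hε =>
    htW.eventually (hw a ha (w a + ε) (by linarith))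
  have hnn : 0 ≤ v a + w a := by
    refine le_of_forall_pos_le_add fun ε hε => ?_
    have h1 : ∀ᶠ k in atTop, 0 ≤ v a + w a + ε + 1 / ((φ k : ℝ) + 1) := by
      filter_upwards [hva (ε / 2) (by positivity), hwa (ε / 2) (by positivity)] with k h1 h2
      linarith [hval (φ k)]
    have h2 := ge_of_tendsto (hθ.const_add (v a + w a + ε)) h1
    linarith
  have ha0 : a = 0 := by
    have h1 := hvw a (by simpa using ha)
    have h2 : ‖a‖ ^ 2 ≤ 0 := by nlinarith
    simpa using h2
  subst ha0
  have hn1 : ∀ᶠ k in atTop, ‖z (φ k)‖ < η := by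
    have := hza.norm
    rw [norm_zero] at this
    exact this.eventually (gt_mem_nhds hη)
  have hn2 : ∀ᶠ k in atTop, ‖t (φ k)‖ < η := by
    have := hta.norm
    rw [norm_zero] at this
    exact this.eventually (gt_mem_nhds hη)
  obtain ⟨k, h1, h2, h3, h4, h5⟩ := (hn1.and (hn2.and ((hva (η / 2) (by positivity)).and
    ((hwa (η / 2) (by positivity)).and (hθ.eventually (gt_mem_nhds (half_pos hη))))))).exists
  have h6 := hval (φ k)
  exact absurd (hbad (φ k) h1 h2 (by linarith)) (by linarith)

/-- The theorem on sums: near a strict maximum of `v + w` there are points at which `v` and `w` are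
touched from above by paraboloids whose second-order parts have almost nonpositive sum. -/
lemma exists_touching_paraboloids [FiniteDimensional ℝ E] {v w : E → ℝ} {c R η : ℝ}
    (hc : 0 < c) (hη : 0 < η) (hR : 0 < R)
    (hv : UpperSemicontinuousOn v (Metric.closedBall 0 R))
    (hw : UpperSemicontinuousOn w (Metric.closedBall 0 R)) (hv0 : v 0 = 0) (hw0 : w 0 = 0)
    (hvw : ∀ x, ‖x‖ ≤ R → v x + w x ≤ -c * ‖x‖ ^ 2) :
    ∃ (z t p q : E) (A B : E →L[ℝ] E), ‖z‖ < η ∧ ‖t‖ < η ∧ -η < v z ∧ -η < w t ∧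
      (∀ᶠ h in 𝓝 (0 : E), v (z + h) ≤ v z + ⟪p, h⟫ + ⟪A h, h⟫) ∧
      (∀ᶠ h in 𝓝 (0 : E), w (t + h) ≤ w t + ⟪q, h⟫ + ⟪B h, h⟫) ∧
      ∀ h, ⟪A h, h⟫ + ⟪B h, h⟫ ≤ η * ‖h‖ ^ 2 := by
  obtain ⟨θ, hθ, hloc⟩ := exists_pos_forall_almost_max hc
    (show 0 < min η (R / 10) by positivity) hv hw hv0 hw0 hvw
  obtain ⟨Mv, hMv⟩ := hv.bddAbove_of_isCompact (isCompact_closedBall (0 : E) R)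
  obtain ⟨Mw, hMw⟩ := hw.bddAbove_of_isCompact (isCompact_closedBall (0 : E) R)
  have hvM : ∀ x, ‖x‖ ≤ R → v x ≤ max Mv 0 := fun x hx =>
    (hMv ⟨x, by simpa using hx, rfl⟩).trans (le_max_left _ _)
  have hwM : ∀ x, ‖x‖ ≤ R → w x ≤ max Mw 0 := fun x hx =>
    (hMw ⟨x, by simpa using hx, rfl⟩).trans (le_max_left _ _)
  set M := max Mv 0 + max Mw 0 with hM
  have hM0 : 0 ≤ M := by positivity
  set τ := min (θ / 2) (R / 10) with hτ
  have hτ0 : 0 < τ := by positivity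
  set l := 2 * (M + θ) / τ ^ 2 with hl
  have hl0 : 0 < l := by positivity
  have hlτ : l / 2 * τ ^ 2 = M + θ := by rw [hl]; field_simp
  obtain ⟨f, Z, hZ, hfs, hfl, hfe⟩ := exists_supConvolution hR.le l hv
  obtain ⟨g, T, hT, hgs, hgl, hge⟩ := exists_supConvolution hR.le l hw
  have hnear : ∀ x, -θ ≤ f x + g x - l * ‖x‖ ^ 2 →
      ‖x‖ ≤ R / 5 ∧ (‖Z x‖ < min η (R / 10) ∧ ‖T x‖ < min η (R / 10) ∧
        -min η (R / 10) < v (Z x) ∧ -min η (R / 10) < w (T x)) := by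
    intro x hx
    rw [hfe, hge] at hx
    have h1 : 0 ≤ l / 2 * ‖x - Z x‖ ^ 2 := by positivity
    have h2 : 0 ≤ l / 2 * ‖x - T x‖ ^ 2 := by positivity
    have h3 := hvM _ (hZ x)
    have h4 := hwM _ (hT x)
    have h5 : ‖x - Z x‖ ≤ τ := by
      refine le_of_sq_le_sq ?_ hτ0.le
      refine le_of_mul_le_mul_left (?_ : l / 2 * _ ≤ l / 2 * _) (by positivity)
      rw [hlτ]
      linarith
    have h6 : ‖x - T x‖ ≤ τ := by
      refine le_of_sq_le_sq ?_ hτ0.le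
      refine le_of_mul_le_mul_left (?_ : l / 2 * _ ≤ l / 2 * _) (by positivity)
      rw [hlτ]
      linarith
    have h7 : τ ≤ θ / 2 := min_le_left _ _
    have h8 : τ ≤ R / 10 := min_le_right _ _
    have h9 : ‖Z x - T x‖ ≤ θ := by
      rw [show Z x - T x = (x - T x) - (x - Z x) by abel]
      exact (norm_sub_le _ _).trans (by linarith)
    have h10 := hloc (Z x) (T x) (hZ x) (hT x) h9 (by linarith)
    refine ⟨?_, h10⟩
    have h11 : ‖x‖ ≤ ‖x - Z x‖ + ‖Z x‖ := by
      simpa using norm_add_le (x - Z x) (Z x)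
    have h12 : min η (R / 10) ≤ R / 10 := min_le_right _ _
    linarith [h10.1]
  have hlip : ∀ {f : E → ℝ} {Z : E → E}, (∀ x, ‖Z x‖ ≤ R) →
      (∀ x y, f x + ⟪l • Z x, y - x⟫ ≤ f y) → Continuous f := by
    intro f Z hZ hf
    refine (LipschitzWith.of_le_add_mul (K := (l * R).toNNReal) fun x y => ?_).continuous
    rw [Real.coe_toNNReal _ (by positivity), dist_comm, dist_eq_norm]
    have h1 := hf x y
    have h2 := (abs_le.1 (abs_real_inner_le_norm (l • Z x) (y - x))).1
    have h3 : ‖l • Z x‖ * ‖y - x‖ ≤ l * R * ‖y - x‖ := by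
      rw [norm_smul, Real.norm_of_nonneg hl0.le]
      gcongr
      exact hZ x
    linarith
  have hfc := hlip hZ hfs
  have hgc := hlip hT hgs
  have h00 : 0 ≤ f 0 + g 0 := by
    have h1 := hfl 0 0 (by simpa using hR.le)
    have h2 := hgl 0 0 (by simpa using hR.le)
    simp only [hv0, hw0, sub_zero, norm_zero] at h1 h2
    linarith
  have hval : ∀ x s : E, ‖x‖ ≤ R → ‖s‖ ≤ θ / R → (∀ y, ‖y‖ ≤ R →
      f y + g y - l * ‖y‖ ^ 2 - ⟪s, y⟫ ≤ f x + g x - l * ‖x‖ ^ 2 - ⟪s, x⟫) →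
      -θ ≤ f x + g x - l * ‖x‖ ^ 2 := by
    intro x s hx hs hmax
    have h1 := hmax 0 (by simpa using hR.le)
    have h2 := (abs_le.1 (abs_real_inner_le_norm s x)).1
    have h3 : ‖s‖ * ‖x‖ ≤ θ / R * R := by gcongr
    rw [div_mul_cancel₀ _ hR.ne'] at h3
    simp only [norm_zero, inner_zero_right] at h1
    linarith
  obtain ⟨x, s, A, B, hs, hxR, hmax, hA, hB, hAB⟩ := exists_contact_hasFDerivAt hfs hgs hl0 hR
    (show 0 < θ / R by positivity) (by
      intro s hs
      have hcont : Continuous fun y => f y + g y - l * ‖y‖ ^ 2 - ⟪s, y⟫ := by fun_prop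
      obtain ⟨x, hx, hmax⟩ := (isCompact_closedBall (0 : E) R).exists_isMaxOn
        ⟨0, by simpa using hR.le⟩ hcont.continuousOn
      have hmax' : ∀ y, ‖y‖ ≤ R →
          f y + g y - l * ‖y‖ ^ 2 - ⟪s, y⟫ ≤ f x + g x - l * ‖x‖ ^ 2 - ⟪s, x⟫ :=
        fun y hy => hmax (show y ∈ Metric.closedBall (0 : E) R by simpa using hy)
      exact ⟨x, (hnear x (hval x s (by simpa using hx) hs hmax')).1, hmax'⟩)
  obtain ⟨-, h1, h2, h3, h4⟩ := hnear x (hval x s (by linarith) hs hmax)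
  have hm1 : min η (R / 10) ≤ η := min_le_left _ _
  have hm2 : min η (R / 10) ≤ R / 10 := min_le_right _ _
  refine ⟨Z x, T x, _, _, _, _, by linarith, by linarith, by linarith, by linarith,
    eventually_le_of_supConvolution hfs hfl hfe (by linarith) hA (half_pos hη),
    eventually_le_of_supConvolution hgs hgl hge (by linarith) hB (half_pos hη), fun h => ?_⟩
  have h5 := hAB h
  simp only [inner_smul_left, RCLike.conj_to_real, inner_add_left,
    add_apply, smul_apply, ContinuousLinearMap.id_apply,
    real_inner_self_eq_norm_sq]
  linarith

end Convex

section Matrices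

open scoped RealInnerProductSpace

lemma mem_PosP_iff {M : SymMat n} :
    M ∈ PosP n ↔ ∀ x : EucSp n, 0 ≤ ⟪x, Matrix.toEuclideanCLM (𝕜 := ℝ) M.1 x⟫ := by
  have hM : M.1.IsHermitian := M.2
  rw [PosP, Set.mem_ofPred_eq, Matrix.posSemidef_iff_dotProduct_mulVec]
  refine ⟨fun h x => ?_, fun h => ⟨hM, fun x => ?_⟩⟩
  · rw [Matrix.inner_toEuclideanCLM]
    simpa using h.2 (WithLp.ofLp x)
  · have := h (WithLp.toLp 2 x)
    rw [Matrix.inner_toEuclideanCLM] at this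
    simpa using this

/-- A positive definite perturbation of an element of a subequation lies in its interior. -/
lemma ConeSubequation.mem_interior_of_le (F : ConeSubequation n) {A B : SymMat n}
    (hA : A ∈ F.carrier) {κ : ℝ} (hκ : 0 < κ)
    (hAB : ∀ x : EucSp n, κ * ‖x‖ ^ 2 ≤ ⟪x, Matrix.toEuclideanCLM (𝕜 := ℝ) (B - A).1 x⟫) :
    B ∈ interior F.carrier := by
  rw [mem_interior_iff_mem_nhds]
  have hcont : Continuous fun M : SymMat n => ‖Matrix.toEuclideanCLM (𝕜 := ℝ) (M - B).1‖ := by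
    have h1 : Continuous fun N : Matrix (Fin n) (Fin n) ℝ =>
        Matrix.toEuclideanCLM (𝕜 := ℝ) N :=
      ({ toFun := fun N => Matrix.toEuclideanCLM (𝕜 := ℝ) N
         map_add' := map_add _
         map_smul' := map_smul _ } : Matrix (Fin n) (Fin n) ℝ →ₗ[ℝ]
          EucSp n →L[ℝ] EucSp n).continuous_of_finiteDimensional
    exact (h1.comp (continuous_subtype_val.comp (continuous_id.sub continuous_const))).norm
  have hmem : {M : SymMat n | ‖Matrix.toEuclideanCLM (𝕜 := ℝ) (M - B).1‖ < κ} ∈ 𝓝 B :=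
    (isOpen_lt hcont continuous_const).mem_nhds (by simpa using hκ)
  filter_upwards [hmem] with M hM
  have hpos : M - A ∈ PosP n := by
    rw [mem_PosP_iff]
    intro x
    have h1 : M - A = (M - B) + (B - A) := by abel
    have h2 := (abs_le.1 (abs_real_inner_le_norm x
      (Matrix.toEuclideanCLM (𝕜 := ℝ) (M - B).1 x))).1
    have h3 := (Matrix.toEuclideanCLM (𝕜 := ℝ) (M - B).1).le_opNorm x
    have h4 : ‖x‖ * ‖Matrix.toEuclideanCLM (𝕜 := ℝ) (M - B).1 x‖ ≤ ‖x‖ * (κ * ‖x‖) := by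
      gcongr
      exact h3.trans (by gcongr)
    have h5 := hAB x
    rw [h1, AddSubgroup.coe_add, map_add, add_apply, inner_add_right]
    linarith
  have := F.f1 A hA _ hpos
  rwa [add_sub_cancel] at this

/-- The Hessian matrix of the quadratic form `x ↦ ⟪A x, x⟫`. -/
def quadHess (A : EucSp n →L[ℝ] EucSp n) : SymMat n :=
  ⟨Matrix.of fun i j => ⟪A (EuclideanSpace.single i 1), EuclideanSpace.single j 1⟫ +
      ⟪A (EuclideanSpace.single j 1), EuclideanSpace.single i 1⟫, by
    rw [selfAdjoint.mem_iff]
    ext i j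
    simp [Matrix.star_apply, add_comm]⟩

lemma inner_toEuclideanCLM_quadHess (A : EucSp n →L[ℝ] EucSp n) (x : EucSp n) :
    ⟪x, Matrix.toEuclideanCLM (𝕜 := ℝ) (quadHess A).1 x⟫ = 2 * ⟪A x, x⟫ := by
  set N := (Matrix.toEuclideanCLM (n := Fin n) (𝕜 := ℝ)).symm A with hN
  have hA : A = Matrix.toEuclideanCLM (𝕜 := ℝ) N := by simp [hN]
  have hq : (quadHess A).1 = N.transpose + N := by
    ext i j
    simp [quadHess, hA, Matrix.ofLp_toEuclideanCLM, EuclideanSpace.inner_single_right]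
  rw [hq, map_add, add_apply, inner_add_right, real_inner_comm x (A x), hA]
  simp only [Matrix.inner_toEuclideanCLM]
  rw [Matrix.mulVec_transpose, dotProduct_comm, ← Matrix.dotProduct_mulVec, two_mul]

/-- The Hessian bilinear form of `x ↦ ⟪A x, x⟫`. -/
lemma hessMatrix_quadratic (a : ℝ) (p z : EucSp n) (A : EucSp n →L[ℝ] EucSp n) :
    hessMatrix (fun x => a + ⟪p, x - z⟫ + ⟪A (x - z), x - z⟫) z = (quadHess A).1 := by
  set B : EucSp n →L[ℝ] EucSp n →L[ℝ] ℝ :=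
    (isBoundedBilinearMap_inner (𝕜 := ℝ) (E := EucSp n)).toContinuousLinearMap.comp A +
      ((isBoundedBilinearMap_inner (𝕜 := ℝ) (E := EucSp n)).toContinuousLinearMap.comp A).flip
    with hB
  have h1 : fderiv ℝ (fun x => a + ⟪p, x - z⟫ + ⟪A (x - z), x - z⟫) =
      fun x => innerSL ℝ p + B (x - z) := by
    ext x h
    have hid : HasFDerivAt (fun y : EucSp n => y - z) (ContinuousLinearMap.id ℝ _) x :=
      (hasFDerivAt_id x).sub_const z
    have := (((hasFDerivAt_const p x).inner ℝ hid).const_add a).fun_add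
      ((A.hasFDerivAt.comp x hid).inner ℝ hid)
    refine (congrArg (fun L : EucSp n →L[ℝ] ℝ => L h) (HasFDerivAt.fderiv this)).trans ?_
    simp [hB, real_inner_comm, add_comm]
    rw [inner_sub_left, inner_sub_right]
    ring
  have h2 : HasFDerivAt (fun x => innerSL ℝ p + B (x - z)) B z :=
    (B.hasFDerivAt.comp z ((hasFDerivAt_id z).sub_const z)).const_add _
  ext i j
  simp only [hessMatrix, Matrix.of_apply, iteratedFDeriv_two_apply]
  rw [h1, h2.fderiv]
  simp [hB, quadHess, real_inner_comm, add_comm]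

/-- If the Hessian of a `C²` function has only negative eigenvalues then the function is locally
bounded above by a strictly concave paraboloid. -/
lemma exists_concave_paraboloid_of_hessMatrix_notMem {ψ : EucSp n → ℝ} {y : EucSp n}
    (hψ : ContDiffAt ℝ 2 ψ y) (hH : hessMatrix ψ y ∉ Subtype.val '' dualSet (PosP n)) :
    ∃ ℓ : EucSp n, ∃ c > 0, ∀ᶠ x in 𝓝 y, ψ x ≤ ψ y + ⟪ℓ, x - y⟫ - c * ‖x - y‖ ^ 2 := by
  set D := fderiv ℝ (fderiv ℝ ψ) y with hD
  have hsymm : ∀ a b, D a b = D b a :=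
    fun a b => (hψ.isSymmSndFDerivAt (by simp)).eq a b
  obtain ⟨A, hA⟩ : ∃ A : EucSp n →L[ℝ] EucSp n, ∀ a b, ⟪A a, b⟫ = 2⁻¹ * D a b := by
    refine ⟨ContinuousLinearMap.comp
      (InnerProductSpace.toDual ℝ (EucSp n)).symm.toContinuousLinearEquiv.toContinuousLinearMap
      ((2⁻¹ : ℝ) • D), fun a b => ?_⟩
    simp [real_inner_smul_left]
  have hM : hessMatrix ψ y = (quadHess A).1 := by
    ext i j
    simp only [hessMatrix, Matrix.of_apply, iteratedFDeriv_two_apply, quadHess, hA]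
    rw [hsymm (EuclideanSpace.single j 1)]
    simp [hD]
    ring
  have hint : -quadHess A ∈ interior (PosP n) := by
    by_contra hcon
    exact hH ⟨quadHess A, hcon, hM.symm⟩
  obtain ⟨κ, hκ, hneg⟩ : ∃ κ > 0, ∀ x : EucSp n, κ * ‖x‖ ^ 2 ≤ - D x x := by
    have hc : Continuous fun t : ℝ => -quadHess A - t • (1 : SymMat n) :=
      continuous_const.sub (Continuous.subtype_mk (f := fun t : ℝ =>
        t • (1 : Matrix (Fin n) (Fin n) ℝ)) (by fun_prop) _)
    have h0 : ∀ᶠ t in 𝓝 (0 : ℝ), -quadHess A - t • (1 : SymMat n) ∈ PosP n := by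
      refine hc.continuousAt.eventually ?_
      simpa using mem_interior_iff_mem_nhds.1 hint
    obtain ⟨κ, hpos, hκ⟩ := ((h0.filter_mono nhdsWithin_le_nhds).and
      (self_mem_nhdsWithin : ∀ᶠ t : ℝ in 𝓝[>] 0, t ∈ Set.Ioi 0)).exists
    refine ⟨κ, hκ, fun x => ?_⟩
    have h1 := mem_PosP_iff.1 hpos x
    have h2 := inner_toEuclideanCLM_quadHess A x
    rw [hA] at h2
    have h3 : (-quadHess A - κ • (1 : SymMat n)).1 =
        -(quadHess A).1 - κ • (1 : Matrix (Fin n) (Fin n) ℝ) := rfl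
    rw [h3, map_sub, map_neg, map_smul, map_one] at h1
    simp [inner_sub_right, inner_neg_right, inner_smul_right, -inner_self_eq_norm_sq_to_K] at h1
    rw [real_inner_self_eq_norm_sq] at h1
    linarith
  obtain ⟨r, hr, hder⟩ : ∃ r > 0, ∀ x ∈ Metric.ball y r, DifferentiableAt ℝ ψ x ∧
      ‖fderiv ℝ ψ x - fderiv ℝ ψ y - D (x - y)‖ ≤ κ / 4 * ‖x - y‖ := by
    have h1 : ∀ᶠ x in 𝓝 y, DifferentiableAt ℝ ψ x :=
      (hψ.eventually (by simp)).mono fun x hx => hx.differentiableAt (by simp)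
    have h2 : HasFDerivAt (fderiv ℝ ψ) D y :=
      ((hψ.fderiv_right (m := 1) (by norm_num)).differentiableAt (by simp)).hasFDerivAt
    exact Metric.eventually_nhds_iff_ball.1 (h1.and (h2.isLittleO.def (by positivity)))
  obtain ⟨ℓ, hℓ⟩ : ∃ ℓ : EucSp n, ∀ a, ⟪ℓ, a⟫ = fderiv ℝ ψ y a :=
    ⟨(InnerProductSpace.toDual ℝ (EucSp n)).symm (fderiv ℝ ψ y), fun a => by simp⟩
  refine ⟨ℓ, κ / 4, by positivity, ?_⟩
  filter_upwards [Metric.ball_mem_nhds y hr] with x hx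
  set g : EucSp n → ℝ := fun z => ψ z - fderiv ℝ ψ y (z - y) - 2⁻¹ * D (z - y) (z - y) with hg
  have hgd : ∀ z ∈ Metric.closedBall y ‖x - y‖,
      HasFDerivWithinAt g (fderiv ℝ ψ z - fderiv ℝ ψ y - D (z - y))
        (Metric.closedBall y ‖x - y‖) z := by
    intro z hz
    have hz' : z ∈ Metric.ball y r := by
      rw [Metric.mem_closedBall] at hz
      rw [Metric.mem_ball, dist_eq_norm] at hx
      exact Metric.mem_ball.2 (hz.trans_lt hx)
    have hid : HasFDerivAt (fun u : EucSp n => u - y) (ContinuousLinearMap.id ℝ _) z :=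
      (hasFDerivAt_id z).sub_const y
    have hq := (D.isBoundedBilinearMap.hasFDerivAt (z - y, z - y)).comp z (hid.prodMk hid)
    have hfin := (((hder z hz').1.hasFDerivAt.fun_sub
      ((fderiv ℝ ψ y).hasFDerivAt.comp z hid)).fun_sub (hq.const_mul 2⁻¹)).hasFDerivWithinAt
      (s := Metric.closedBall y ‖x - y‖)
    refine hfin.congr_fderiv ?_
    ext u
    simp [hsymm u]
    ring
  have hmv := (convex_closedBall y ‖x - y‖).norm_image_sub_le_of_norm_hasFDerivWithin_le hgd
    (C := κ / 4 * ‖x - y‖) (fun z hz => by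
      have hz' : z ∈ Metric.ball y r := by
        rw [Metric.mem_closedBall] at hz
        rw [Metric.mem_ball, dist_eq_norm] at hx
        exact Metric.mem_ball.2 (hz.trans_lt hx)
      rw [Metric.mem_closedBall, dist_eq_norm] at hz
      exact (hder z hz').2.trans (by gcongr))
    (Metric.mem_closedBall_self (norm_nonneg _))
    (show x ∈ Metric.closedBall y ‖x - y‖ by simp [dist_eq_norm])
  have hle := (abs_le.1 (hmv : |g x - g y| ≤ _)).2
  simp only [hg, sub_self, map_zero, mul_zero, sub_zero] at hle
  rw [hℓ]
  nlinarith [hneg (x - y)]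

end Matrices

section Subharmonic

open scoped RealInnerProductSpace

lemma FSubharmonicOn.quadHess_mem {S : Set (SymMat n)} {X : Set (EucSp n)} {v : EucSp n → EReal}
    (hv : FSubharmonicOn S X v) {z p : EucSp n} (hz : z ∈ X) {ρ : ℝ} (hρ : v z = ρ)
    {A : EucSp n →L[ℝ] EucSp n}
    (hle : ∀ᶠ h in 𝓝 (0 : EucSp n), v (z + h) ≤ ((ρ + ⟪p, h⟫ + ⟪A h, h⟫ : ℝ) : EReal)) :
    quadHess A ∈ S := by
  have htest : IsTestAt X v (fun x => ρ + ⟪p, x - z⟫ + ⟪A (x - z), x - z⟫) z := by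
    refine ⟨((contDiff_const.add (contDiff_const.inner ℝ (by fun_prop))).add
      (ContDiff.inner ℝ (by fun_prop) (by fun_prop))).contDiffAt, ?_, by simp [hρ]⟩
    have ht : Tendsto (fun x => x - z) (𝓝 z) (𝓝 0) := by
      have hc : Continuous fun x => x - z := by fun_prop
      simpa using hc.tendsto z
    refine (ht.eventually hle).filter_mono nhdsWithin_le_nhds |>.mono fun x hx => ?_
    simpa using hx
  obtain ⟨M, hM, hMe⟩ := hv.2.2 z hz _ htest
  rw [hessMatrix_quadratic] at hMe
  rwa [Subtype.ext hMe] at hM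

/-- The real number `a * (e - α)`, truncated below at `-1`. -/
def truncAt (a α : ℝ) (e : EReal) : ℝ :=
  if e = ⊥ then -1 else max (a * (e.toReal - α)) (-1)

lemma neg_one_le_truncAt (a α : ℝ) (e : EReal) : -1 ≤ truncAt a α e := by
  unfold truncAt
  split_ifs <;> simp

lemma truncAt_coe_self (a α : ℝ) : truncAt a α (α : EReal) = 0 := by
  simp [truncAt]

lemma truncAt_lt {a α r : ℝ} (ha : 0 < a) (hr : -1 < r) {e : EReal}
    (he : e < ((α + r / a : ℝ) : EReal)) : truncAt a α e < r := by
  induction e with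
  | bot => simpa [truncAt]
  | top => simp at he
  | coe x =>
    rw [EReal.coe_lt_coe_iff] at he
    simp only [truncAt, EReal.coe_ne_bot, if_false, EReal.toReal_coe, max_lt_iff]
    refine ⟨?_, hr⟩
    rwa [← lt_div_iff₀' ha, sub_lt_iff_lt_add']

lemma le_coe_truncAt {a α : ℝ} (ha : 0 < a) {e : EReal} (he : e ≠ ⊤) :
    e ≤ ((α + truncAt a α e / a : ℝ) : EReal) := by
  induction e with
  | bot => simp
  | top => simp at he
  | coe x =>
    rw [EReal.coe_le_coe_iff, ← sub_le_iff_le_add', le_div_iff₀' ha]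
    simp [truncAt]

lemma exists_eq_coe_of_neg_one_lt_truncAt {a α : ℝ} {e : EReal} (he : e ≠ ⊤)
    (h : -1 < truncAt a α e) : ∃ ρ : ℝ, e = ρ ∧ truncAt a α e = a * (ρ - α) := by
  induction e with
  | bot => simp [truncAt] at h
  | top => simp at he
  | coe x =>
    refine ⟨x, rfl, ?_⟩
    simp only [truncAt, EReal.coe_ne_bot, if_false, EReal.toReal_coe, lt_max_iff,
      lt_irrefl, or_false] at h ⊢
    exact max_eq_left h.le

lemma UpperSemicontinuousOn.truncAt {X : Set (EucSp n)} {v : EucSp n → EReal}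
    (hv : UpperSemicontinuousOn v X) (hv' : ∀ x ∈ X, v x ≠ ⊤) {a : ℝ} (ha : 0 < a) (α : ℝ) :
    UpperSemicontinuousOn (fun x => truncAt a α (v x)) X := by
  intro x hx r hr
  have h1 : -1 < r := (neg_one_le_truncAt a α (v x)).trans_lt hr
  have h2 : v x < ((α + r / a : ℝ) : EReal) :=
    (le_coe_truncAt ha (hv' x hx)).trans_lt (EReal.coe_lt_coe_iff.2 (by gcongr))
  exact (hv x hx _ h2).mono fun y hy => truncAt_lt ha h1 hy

/-- The sum of a positive multiple of an `F`-subharmonic function and an `F̃`-subharmonic function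
cannot be touched from above by a strictly concave paraboloid. -/
lemma not_eventually_add_le_paraboloid (F : ConeSubequation n) {X : Set (EucSp n)}
    (hX : IsOpen X) {v w : EucSp n → EReal} (hv : FSubharmonicOn F.carrier X v)
    (hw : FSubharmonicOn (dualSet F.carrier) X w) {y : EucSp n} (hy : y ∈ X) {α β a c : ℝ}
    (ha : 0 < a) (hc : 0 < c) (hvy : v y = α) (hwy : w y = β) (ℓ : EucSp n) :
    ¬ ∀ᶠ x in 𝓝 y, ∀ r s : ℝ, v x = r → w x = s →
      a * r + s ≤ a * α + β + ⟪ℓ, x - y⟫ - c * ‖x - y‖ ^ 2 := by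
  intro hle
  set V : EucSp n → ℝ := fun x => truncAt a α (v x) with hV
  set W : EucSp n → ℝ := fun x => truncAt 1 β (w x) with hW
  have hVusc : UpperSemicontinuousOn V X := hv.1.truncAt hv.2.1 ha α
  have hWusc : UpperSemicontinuousOn W X := hw.1.truncAt hw.2.1 one_pos β
  have hVy : V y = 0 := by simp [hV, hvy, truncAt_coe_self]
  have hWy : W y = 0 := by simp [hW, hwy, truncAt_coe_self]
  have hXy : X ∈ 𝓝 y := hX.mem_nhds hy
  have eV : ∀ᶠ x in 𝓝 y, V x < 1 / 2 := by
    have := hVusc y hy (1 / 2) (show V y < 1 / 2 by rw [hVy]; norm_num)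
    rwa [hX.nhdsWithin_eq hy] at this
  have eW : ∀ᶠ x in 𝓝 y, W x < 1 / 2 := by
    have := hWusc y hy (1 / 2) (show W y < 1 / 2 by rw [hWy]; norm_num)
    rwa [hX.nhdsWithin_eq hy] at this
  have eQ : ∀ᶠ x in 𝓝 y, -(1 / 2) < ⟪ℓ, x - y⟫ - c * ‖x - y‖ ^ 2 := by
    have hcont : Continuous fun x => ⟪ℓ, x - y⟫ - c * ‖x - y‖ ^ 2 := by fun_prop
    exact hcont.continuousAt.eventually_const_lt (by simp)
  obtain ⟨R, hR, hball⟩ := Metric.nhds_basis_closedBall.eventually_iff.1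
    (hle.and (eV.and (eW.and (eQ.and hXy))))
  have hmem : ∀ x : EucSp n, ‖x‖ ≤ R → y + x ∈ Metric.closedBall y R := by
    intro x hx
    simpa [dist_eq_norm] using hx
  have hmaps : Set.MapsTo (fun x => y + x) (Metric.closedBall (0 : EucSp n) R) X :=
    fun x hx => (hball (hmem x (by simpa using hx))).2.2.2.2
  have hadd : ContinuousOn (fun x => y + x) (Metric.closedBall (0 : EucSp n) R) := by fun_prop
  have hη : 0 < min (min (c / 4) (1 / 4)) R := by positivity
  obtain ⟨z, t, p, q, A, B, hz, ht, hvz, hwt, hAz, hBt, hAB⟩ :=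
    exists_touching_paraboloids (v := fun x => V (y + x) - ⟪ℓ, x⟫ + c / 2 * ‖x‖ ^ 2)
      (w := fun x => W (y + x)) (c := c / 2) (R := R) (η := min (min (c / 4) (1 / 4)) R)
      (by positivity) hη hR
      (by
        have h1 := UpperSemicontinuousOn.comp hVusc hadd hmaps
        have h2 : ContinuousOn (fun x => - ⟪ℓ, x⟫ + c / 2 * ‖x‖ ^ 2)
          (Metric.closedBall (0 : EucSp n) R) := by fun_prop
        have := h1.add h2.upperSemicontinuousOn
        simpa [sub_eq_add_neg, add_assoc, Function.comp_def] using this)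
      (UpperSemicontinuousOn.comp hWusc hadd hmaps) (by simpa using hVy) (by simpa using hWy)
      (by
        intro x hx
        obtain ⟨b1, b2, b3, b4, b5⟩ := hball (hmem x hx)
        rw [add_sub_cancel_left] at b1 b4
        suffices V (y + x) + W (y + x) ≤ ⟪ℓ, x⟫ - c * ‖x‖ ^ 2 by linarith
        by_cases hV1 : -1 < V (y + x)
        · by_cases hW1 : -1 < W (y + x)
          · obtain ⟨r, hr, hr'⟩ := exists_eq_coe_of_neg_one_lt_truncAt (hv.2.1 _ b5) hV1
            obtain ⟨s, hs, hs'⟩ := exists_eq_coe_of_neg_one_lt_truncAt (hw.2.1 _ b5) hW1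
            have := b1 r s hr hs
            simp only [hV, hW, hr', hs']
            linarith
          · linarith
        · linarith)
  have hηc := (min_le_left (min (c / 4) (1 / 4)) R).trans (min_le_left _ _)
  have hη1 := (min_le_left (min (c / 4) (1 / 4)) R).trans (min_le_right _ _)
  have hηR := min_le_right (min (c / 4) (1 / 4)) R
  set η := min (min (c / 4) (1 / 4)) R
  obtain ⟨-, -, -, bz, bzX⟩ := hball (hmem z (hz.le.trans hηR))
  obtain ⟨-, -, -, -, btX⟩ := hball (hmem t (ht.le.trans hηR))
  rw [add_sub_cancel_left] at bz
  obtain ⟨r, hr, hr'⟩ := exists_eq_coe_of_neg_one_lt_truncAt (a := a) (α := α) (hv.2.1 _ bzX)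
    (show -1 < V (y + z) by nlinarith [sq_nonneg ‖z‖])
  obtain ⟨s, hs, hs'⟩ := exists_eq_coe_of_neg_one_lt_truncAt (a := 1) (α := β) (hw.2.1 _ btX)
    (show -1 < W (y + t) by linarith)
  have hnhds : ∀ z : EucSp n, y + z ∈ X → ∀ᶠ h in 𝓝 (0 : EucSp n), y + z + h ∈ X := by
    intro z hz
    have : Tendsto (fun h => y + z + h) (𝓝 0) (𝓝 (y + z)) := by
      have hc : Continuous fun h => y + z + h := by fun_prop
      simpa using hc.tendsto 0
    exact this.eventually (hX.mem_nhds hz)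
  have hA : quadHess (a⁻¹ • (A - (c / 2) • ContinuousLinearMap.id ℝ (EucSp n))) ∈ F.carrier := by
    refine hv.quadHess_mem (p := a⁻¹ • (p + ℓ - c • z)) bzX hr ?_
    filter_upwards [hAz, hnhds z bzX] with h hh hX'
    refine (le_coe_truncAt ha (hv.2.1 _ hX') (α := α)).trans (EReal.coe_le_coe_iff.2 ?_)
    have e1 : V (y + (z + h)) = truncAt a α (v (y + z + h)) := by simp [hV, add_assoc]
    have e2 : V (y + z) = a * (r - α) := hr'
    rw [e1, e2] at hh
    rw [← sub_nonneg] at hh ⊢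
    have e3 := norm_add_sq_real z h
    simp only [e3, inner_add_right, inner_add_left, inner_sub_left, real_inner_smul_left,
      smul_apply, sub_apply, ContinuousLinearMap.id_apply,
      real_inner_self_eq_norm_sq] at hh ⊢
    refine (mul_nonneg (inv_nonneg.2 ha.le) hh).trans_eq ?_
    field_simp
    ring
  have hB : quadHess B ∈ dualSet F.carrier := by
    refine hw.quadHess_mem (p := q) btX hs ?_
    filter_upwards [hBt, hnhds t btX] with h hh hX'
    refine (le_coe_truncAt one_pos (hw.2.1 _ hX') (α := β)).trans (EReal.coe_le_coe_iff.2 ?_)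
    have e1 : W (y + (t + h)) = truncAt 1 β (w (y + t + h)) := by simp [hW, add_assoc]
    have e2 : W (y + t) = 1 * (s - β) := hs'
    rw [e1, e2] at hh
    linarith
  refine hB (F.mem_interior_of_le (F.f2 _ hA a ha) (κ := c / 2) (by positivity) fun x => ?_)
  have e : (-quadHess B - a • quadHess
      (a⁻¹ • (A - (c / 2) • ContinuousLinearMap.id ℝ (EucSp n)))).1 = -(quadHess B).1 - a •
      (quadHess (a⁻¹ • (A - (c / 2) • ContinuousLinearMap.id ℝ (EucSp n)))).1 := rfl
  rw [e, map_sub, map_neg, map_smul, sub_apply, neg_apply, smul_apply, inner_sub_right,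
    inner_neg_right, inner_smul_right, inner_toEuclideanCLM_quadHess,
    inner_toEuclideanCLM_quadHess]
  simp only [smul_apply, sub_apply,
    ContinuousLinearMap.id_apply, real_inner_smul_left, inner_sub_left,
    real_inner_self_eq_norm_sq]
  have h1 := hAB x
  have h2 : η * ‖x‖ ^ 2 ≤ c / 4 * ‖x‖ ^ 2 := by gcongr
  have h3 : a * (2 * (a⁻¹ * (⟪A x, x⟫ - c / 2 * ‖x‖ ^ 2))) = 2 * ⟪A x, x⟫ - c * ‖x‖ ^ 2 := by
    field_simp
  rw [h3]
  linarith

end Subharmonic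

section Singularity

open scoped RealInnerProductSpace

/-- A lower bound for the lower limit of a difference quotient, in terms of real numbers. -/
lemma eventually_mul_le_of_le_liminf_div {h v : EucSp n → EReal} {x₀ : EucSp n} {α η c δ : ℝ}
    (hα : v x₀ = α) (hη : h x₀ = η) (hδ : 0 < δ)
    (hh : ∀ᶠ y in 𝓝[≠] x₀, h x₀ < h y ∧ h y ≠ ⊤) (hv : ∀ᶠ y in 𝓝[≠] x₀, v y ≠ ⊤)
    (hlim : (c : EReal) ≤ liminf (fun y => (v y - v x₀) / (h y - h x₀)) (𝓝[≠] x₀)) :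
    ∀ᶠ y in 𝓝[≠] x₀, ∃ r s : ℝ, v y = r ∧ h y = s ∧ η < s ∧ (c - δ) * (s - η) ≤ r - α := by
  have hlt : ((c - δ : ℝ) : EReal) < liminf (fun y => (v y - v x₀) / (h y - h x₀)) (𝓝[≠] x₀) :=
    (EReal.coe_lt_coe_iff.2 (by linarith)).trans_le hlim
  filter_upwards [eventually_lt_of_lt_liminf hlt, hh, hv] with y hy hhy hvy
  rw [hα, hη] at hy
  rw [hη] at hhy
  obtain ⟨s, hs⟩ : ∃ s : ℝ, h y = s :=
    ⟨_, (EReal.coe_toReal hhy.2 (ne_bot_of_gt hhy.1)).symm⟩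
  rw [hs] at hy hhy
  have hs' : η < s := EReal.coe_lt_coe_iff.1 hhy.1
  have hvb : v y ≠ ⊥ := by
    intro hb
    rw [hb, EReal.bot_sub, ← EReal.coe_sub, EReal.bot_div_of_pos_ne_top
      (EReal.coe_pos.2 (sub_pos.2 hs')) (EReal.coe_ne_top _)] at hy
    exact not_lt_bot hy
  obtain ⟨r, hr⟩ : ∃ r : ℝ, v y = r := ⟨_, (EReal.coe_toReal hvy hvb).symm⟩
  refine ⟨r, s, hr, hs, hs', ?_⟩
  rw [hr, ← EReal.coe_sub, ← EReal.coe_sub, ← EReal.coe_div, EReal.coe_lt_coe_iff,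
    lt_div_iff₀ (sub_pos.2 hs')] at hy
  exact hy.le

/-- At a finite type singularity, a strictly concave paraboloid through the singular value cannot
bound the sum of the two functions from above. -/
lemma not_eventually_add_le_paraboloid_singular (F : ConeSubequation n) {x₀ : EucSp n}
    {h : EucSp n → EReal} {U : Set (EucSp n)} (hU : IsOpen U) (hx₀ : x₀ ∈ U)
    {v w : EucSp n → EReal}
    (hvusc : UpperSemicontinuousOn v U) (hwusc : UpperSemicontinuousOn w U)
    (hv : FSubharmonicOn F.carrier (U \ {x₀}) v)
    (hw : FSubharmonicOn (dualSet F.carrier) (U \ {x₀}) w)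
    {α β η c : ℝ} (hα : v x₀ = α) (hβ : w x₀ = β) (hη : h x₀ = η) (hc : 0 < c) (ℓ : EucSp n)
    (hv1 : ∀ δ > 0, ∀ᶠ y in 𝓝[≠] x₀, ∃ r s : ℝ, v y = r ∧ h y = s ∧ η < s ∧
      (1 - δ) * (s - η) ≤ r - α)
    (hw1 : ∀ δ > 0, ∀ᶠ y in 𝓝[≠] x₀, ∃ r s : ℝ, w y = r ∧ h y = s ∧ η < s ∧
      (-1 - δ) * (s - η) ≤ r - β)
    (hno : ∀ (q : EucSp n) (k : ℝ),
      ¬ ∀ᶠ x in 𝓝 x₀, h x ≤ ((η + ⟪q, x - x₀⟫ + k * ‖x - x₀‖ ^ 2 : ℝ) : EReal))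
    (hle : ∀ᶠ x in 𝓝[≠] x₀, v x + w x ≤
      ((α + β + ⟪ℓ, x - x₀⟫ - c * ‖x - x₀‖ ^ 2 : ℝ) : EReal)) : False := by
  have hvα : ∀ᶠ x in 𝓝 x₀, v x < ((α + 1 : ℝ) : EReal) := by
    have := hvusc x₀ hx₀ ((α + 1 : ℝ) : EReal)
      (show v x₀ < _ by rw [hα]; exact EReal.coe_lt_coe_iff.2 (by linarith))
    rwa [hU.nhdsWithin_eq hx₀] at this
  obtain ⟨R, hR, hball⟩ := Metric.nhds_basis_closedBall.eventually_iff.1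
    ((eventually_nhdsWithin_iff.1 ((hv1 1 one_pos).and ((hw1 1 one_pos).and hle))).and
      (hvα.and (hU.mem_nhds hx₀)))
  have hreal : ∀ x ∈ Metric.closedBall x₀ R,
      v x = ((v x).toReal : EReal) ∧ w x = ((w x).toReal : EReal) := by
    intro x hx
    by_cases hxx : x = x₀
    · rw [hxx, hα, hβ]
      simp
    · obtain ⟨⟨r, -, hr, -⟩, ⟨s, -, hs, -⟩, -⟩ := (hball hx).1 hxx
      rw [hr, hs]
      simp
  have husc : ∀ {f : EucSp n → EReal}, UpperSemicontinuousOn f U →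
      (∀ x ∈ Metric.closedBall x₀ R, f x = ((f x).toReal : EReal)) →
      UpperSemicontinuousOn (fun x => (f x).toReal) (Metric.closedBall x₀ R) := by
    intro f hf hfr x hx r hr
    have h1 : f x < (r : EReal) := by
      rw [hfr x hx]
      exact EReal.coe_lt_coe_iff.2 hr
    have h2 := (hf.mono fun y hy => (hball hy).2.2) x hx _ h1
    filter_upwards [h2, self_mem_nhdsWithin] with y hy hyR
    rw [hfr y hyR] at hy
    exact EReal.coe_lt_coe_iff.1 hy
  set f : EucSp n → ℝ := fun x => (v x).toReal with hf
  set g : EucSp n → ℝ := fun x => (w x).toReal with hg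
  have hfα : f x₀ = α := by simp [hf, hα]
  have hgβ : g x₀ = β := by simp [hg, hβ]
  have hfusc := husc hvusc fun x hx => (hreal x hx).1
  have hgusc := husc hwusc fun x hx => (hreal x hx).2
  obtain ⟨ε, hε, hε1, hεR⟩ : ∃ ε : ℝ, 0 < ε ∧ ε ≤ 1 ∧ ε ≤ c * R ^ 2 / 4 :=
    ⟨min 1 (c * R ^ 2 / 4), by positivity, min_le_left _ _, min_le_right _ _⟩
  set m : EucSp n → ℝ :=
    fun x => (1 + ε) * f x + g x + (c / 2 * ‖x - x₀‖ ^ 2 - ⟪ℓ, x - x₀⟫) with hm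
  have hmusc : UpperSemicontinuousOn m (Metric.closedBall x₀ R) := by
    have h1 : UpperSemicontinuousOn ((fun t : ℝ => (1 + ε) * t) ∘ f) (Metric.closedBall x₀ R) :=
      Continuous.comp_upperSemicontinuousOn (by fun_prop) hfusc
        (monotone_id.const_mul (by linarith))
    have h2 : Continuous fun x => c / 2 * ‖x - x₀‖ ^ 2 - ⟪ℓ, x - x₀⟫ := by fun_prop
    exact (h1.add hgusc).add h2.continuousOn.upperSemicontinuousOn
  obtain ⟨y, hyR, hmax⟩ := UpperSemicontinuousOn.exists_isMaxOn
    ⟨x₀, Metric.mem_closedBall_self hR.le⟩ (isCompact_closedBall x₀ R) hmusc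
  have hmx₀ : m x₀ = (1 + ε) * α + β := by simp [hm, hfα, hgβ]
  by_cases hy : y = x₀
  · rw [hy] at hmax
    refine hno ((4 / ε) • ℓ) (-(4 / ε * (c / 2))) ?_
    have hδ : 0 < ε / 4 := by positivity
    filter_upwards [eventually_nhdsWithin_iff.1 (hv1 _ hδ), eventually_nhdsWithin_iff.1 (hw1 _ hδ),
      Metric.closedBall_mem_nhds x₀ hR] with x hx1 hx2 hxR
    by_cases hxx : x = x₀
    · rw [hxx, hη]
      simp
    obtain ⟨r, s, hr, hs, hηs, hrs⟩ := hx1 hxx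
    obtain ⟨r', s', hr', hs', -, hrs'⟩ := hx2 hxx
    obtain rfl : s = s' := EReal.coe_eq_coe_iff.1 (hs.symm.trans hs')
    have hmx : m x ≤ m x₀ := hmax hxR
    rw [hmx₀] at hmx
    simp only [hm, hf, hg, hr, hr', EReal.toReal_coe] at hmx
    rw [hs, EReal.coe_le_coe_iff, real_inner_smul_left]
    have h1 : (1 + ε) * ((1 - ε / 4) * (s - η)) ≤ (1 + ε) * (r - α) := by gcongr
    have h2 : ε / 4 * (s - η) ≤ ((1 + ε) * (1 - ε / 4) + (-1 - ε / 4)) * (s - η) :=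
      mul_le_mul_of_nonneg_right (by nlinarith) (by linarith)
    have h3 : ε / 4 * (s - η) ≤ ⟪ℓ, x - x₀⟫ - c / 2 * ‖x - x₀‖ ^ 2 := by linarith
    have h4 : s - η ≤ 4 / ε * (⟪ℓ, x - x₀⟫ - c / 2 * ‖x - x₀‖ ^ 2) := by
      rw [div_mul_eq_mul_div, le_div_iff₀ hε]
      linarith
    linarith
  · have hyU := (hball hyR).2.2
    have hmy : m x₀ ≤ m y := hmax (Metric.mem_closedBall_self hR.le)
    have hlt : ‖y - x₀‖ < R := by
      rw [Metric.mem_closedBall, dist_eq_norm] at hyR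
      refine lt_of_le_of_ne hyR fun hyeq => ?_
      obtain ⟨b1, b2, -⟩ := hball (Metric.mem_closedBall.2 ((dist_eq_norm _ _).trans_le hyR))
      have b3 := (b1 hy).2.2
      obtain ⟨b4, b5⟩ := hreal y (Metric.mem_closedBall.2 ((dist_eq_norm _ _).trans_le hyR))
      rw [b4, b5, ← EReal.coe_add, EReal.coe_le_coe_iff, hyeq] at b3
      rw [b4, EReal.coe_lt_coe_iff] at b2
      rw [hmx₀] at hmy
      simp only [hm, hyeq] at hmy
      have b6 : ε * f y < ε * (α + 1) := mul_lt_mul_of_pos_left b2 hε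
      have b7 : 0 < c * R ^ 2 := by positivity
      simp only [hf, hg] at hmy b6
      linarith
    have hX : IsOpen (U \ {x₀}) := hU.sdiff isClosed_singleton
    refine not_eventually_add_le_paraboloid F hX hv hw (y := y) ⟨hyU, hy⟩ (a := 1 + ε) (c := c / 2)
      (by linarith) (by linarith) (hreal y hyR).1 (hreal y hyR).2 (ℓ - c • (y - x₀)) ?_
    have hnear : Metric.closedBall x₀ R ∈ 𝓝 y :=
      mem_of_superset (Metric.isOpen_ball.mem_nhds (Metric.mem_ball.2 (by rwa [dist_eq_norm])))
        Metric.ball_subset_closedBall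
    filter_upwards [hnear] with x hxR r s hr hs
    have hmx : m x ≤ m y := hmax hxR
    have e1 : x - x₀ = (x - y) + (y - x₀) := by abel
    have e2 := norm_add_sq_real (x - y) (y - x₀)
    simp only [hm] at hmx
    rw [e1, e2, inner_add_right] at hmx
    rw [inner_sub_left, real_inner_smul_left, real_inner_comm (x - y) (y - x₀)]
    simp only [hf, hg, hr, hs, EReal.toReal_coe] at hmx
    linarith

lemma upperSemicontinuousOn_update_limsup {X : Type*} [TopologicalSpace X] [T1Space X]
    [DecidableEq X] {U : Set X} {x₀ : X} {f : X → EReal}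
    (hf : UpperSemicontinuousOn f U) :
    UpperSemicontinuousOn (Function.update f x₀ (limsup f (𝓝[≠] x₀))) U := by
  intro x hx r hr
  by_cases hxx : x = x₀
  · subst hxx
    have hr' : limsup f (𝓝[≠] x) < r := by simpa using hr
    have h1 := eventually_nhdsWithin_iff.1 (eventually_lt_of_limsup_lt hr')
    refine h1.filter_mono nhdsWithin_le_nhds |>.mono fun y hy => ?_
    by_cases hyx : y = x
    · rw [hyx]
      exact hr
    · simpa [Function.update_of_ne hyx] using hy hyx
  · have hr' : f x < r := by simpa [Function.update_of_ne hxx] using hr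
    filter_upwards [hf x hx r hr', nhdsWithin_le_nhds (isOpen_ne.mem_nhds hxx)] with y hy hyx
    simpa [Function.update_of_ne hyx] using hy

end Singularity

/-- Lemma 5.3, finite case: with h a downward-pointing singular F-harmonic
of finite type at x₀, v F-subharmonic and w F̃-subharmonic on a deleted neighborhood of x₀,
and liminf (v−v(x₀))/(h−h(x₀)) ≥ 1, liminf (w−w(x₀))/(h−h(x₀)) ≥ −1 at x₀, the function
u = v + w, redefined at x₀ by its limsup, is subaffine on a neighborhood of x₀. -/
theorem dirichlet_singularities_stmt6 {n : ℕ} (F : ConeSubequation n) (x₀ : EucSp n)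
    (V : Set (EucSp n)) (h : EucSp n → EReal) (hh : DPSingular F V x₀ h)
    (hfin : h x₀ ≠ ⊥)
    (U : Set (EucSp n)) (hU : IsOpen U) (hx₀ : x₀ ∈ U)
    (v w : EucSp n → EReal)
    (hvusc : UpperSemicontinuousOn v U) (hwusc : UpperSemicontinuousOn w U)
    (hvtop : ∀ y ∈ U, v y ≠ ⊤) (hwtop : ∀ y ∈ U, w y ≠ ⊤)
    (hv : FSubharmonicOn F.carrier (U \ {x₀}) v)
    (hw : FSubharmonicOn (dualSet F.carrier) (U \ {x₀}) w)
    (hv1 : (1 : EReal) ≤ Filter.liminf (fun y => (v y - v x₀) / (h y - h x₀)) (𝓝[≠] x₀))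
    (hw1 : (-1 : EReal) ≤ Filter.liminf (fun y => (w y - w x₀) / (h y - h x₀)) (𝓝[≠] x₀)) :
    ∃ W : Set (EucSp n), IsOpen W ∧ x₀ ∈ W ∧
      SubaffineOn W (Function.update (fun y => v y + w y) x₀
        (Filter.limsup (fun y => v y + w y) (𝓝[≠] x₀))) := by
  have hsum : UpperSemicontinuousOn (fun y => v y + w y) U :=
    hvusc.add' hwusc fun x hx =>
      EReal.continuousAt_add (.inl (hvtop x hx)) (.inr (hwtop x hx))
  have hsumtop : ∀ y ∈ U, v y + w y ≠ ⊤ := fun y hy =>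
    (EReal.add_lt_top (hvtop y hy) (hwtop y hy)).ne
  have hL : limsup (fun y => v y + w y) (𝓝[≠] x₀) ≤ v x₀ + w x₀ := by
    have hat : UpperSemicontinuousAt (fun y => v y + w y) x₀ := by
      intro r hr
      have := hsum x₀ hx₀ r hr
      rwa [hU.nhdsWithin_eq hx₀] at this
    exact (limsup_le_limsup_of_le nhdsWithin_le_nhds).trans hat.limsup_le
  have hsplit : ∀ {x r s : EReal}, x ≠ ⊤ → r ≠ ⊤ → s ≠ ⊥ → s ≤ x + r →
      x = (x.toReal : EReal) ∧ r = (r.toReal : EReal) := by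
    intro x r s hx hr hs hle
    have hb : x + r ≠ ⊥ := fun hb => hs (le_bot_iff.1 (hb ▸ hle))
    rw [Ne, EReal.add_eq_bot_iff, not_or] at hb
    exact ⟨(EReal.coe_toReal hx hb.1).symm, (EReal.coe_toReal hr hb.2).symm⟩
  refine ⟨U, hU, hx₀, upperSemicontinuousOn_update_limsup hsum, ?_, ?_⟩
  · intro y hy
    by_cases hyx : y = x₀
    · rw [hyx, Function.update_self]
      exact (hL.trans_lt (hsumtop x₀ hx₀).lt_top).ne
    · rw [Function.update_of_ne hyx]
      exact hsumtop y hy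
  · rintro y hy ψ ⟨hψ, hle, heq⟩
    by_contra hH
    obtain ⟨ℓ, c, hc, hpar⟩ := exists_concave_paraboloid_of_hessMatrix_notMem hψ hH
    rw [hU.nhdsWithin_eq hy] at hle
    by_cases hyx : y = x₀
    · subst hyx
      rw [Function.update_self] at heq
      rw [heq] at hL
      obtain ⟨hα, hβ⟩ := hsplit (hvtop y hy) (hwtop y hy) (EReal.coe_ne_bot _) hL
      have hη : h y = ((h y).toReal : EReal) :=
        (EReal.coe_toReal (hh.subh.2.1 y hh.mem) hfin).symm
      have hψle : ψ y ≤ (v y).toReal + (w y).toReal := by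
        rw [hα, hβ, ← EReal.coe_add, EReal.coe_le_coe_iff] at hL
        exact hL
      have hev : ∀ᶠ x in 𝓝[≠] y, h y < h x ∧ h x ≠ ⊤ := by
        filter_upwards [nhdsWithin_le_nhds (hh.isOpen'.mem_nhds hh.mem), self_mem_nhdsWithin]
          with x hxV hxy
        exact ⟨hh.strictMin x hxV hxy, hh.subh.2.1 x hxV⟩
      have hvt : ∀ᶠ x in 𝓝[≠] y, v x ≠ ⊤ :=
        (eventually_of_mem (hU.mem_nhds hy) hvtop).filter_mono nhdsWithin_le_nhds
      have hwt : ∀ᶠ x in 𝓝[≠] y, w x ≠ ⊤ :=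
        (eventually_of_mem (hU.mem_nhds hy) hwtop).filter_mono nhdsWithin_le_nhds
      have hno : NoTestAt V h y := (hh.polarOrFinite.resolve_left hfin).2
      refine not_eventually_add_le_paraboloid_singular F hU hy hvusc hwusc hv hw hα hβ hη hc ℓ
        (fun δ hδ => eventually_mul_le_of_le_liminf_div hα hη hδ hev hvt (by simpa using hv1))
        (fun δ hδ => eventually_mul_le_of_le_liminf_div hβ hη hδ hev hwt (by simpa using hw1))
        (fun q k hk => hno _ ⟨?_, hk.filter_mono nhdsWithin_le_nhds, by simpa using hη⟩) ?_
      · exact ((contDiff_const.add (contDiff_const.inner ℝ (by fun_prop))).add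
          (contDiff_const.mul ((contDiff_id.sub contDiff_const).norm_sq ℝ))).contDiffAt
      · filter_upwards [hle.filter_mono nhdsWithin_le_nhds, hpar.filter_mono nhdsWithin_le_nhds,
          self_mem_nhdsWithin] with x hx1 hx2 hxy
        rw [Function.update_of_ne hxy] at hx1
        exact hx1.trans (EReal.coe_le_coe_iff.2 (by linarith))
    · rw [Function.update_of_ne hyx] at heq
      obtain ⟨hα, hβ⟩ := hsplit (hvtop y hy) (hwtop y hy) (EReal.coe_ne_bot _) heq.ge
      refine not_eventually_add_le_paraboloid F (hU.sdiff isClosed_singleton) hv hw ⟨hy, hyx⟩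
        one_pos hc hα hβ ℓ ?_
      filter_upwards [hle, hpar, isOpen_ne.mem_nhds hyx] with x hx1 hx2 hxy r s hr hs
      rw [Function.update_of_ne hxy, hr, hs, ← EReal.coe_add, EReal.coe_le_coe_iff] at hx1
      rw [hα, hβ, ← EReal.coe_add, EReal.coe_eq_coe_iff] at heq
      linarith
end
end

section
/- Let F be a cone subequation on ℝⁿ with dual F̃, Ω ⊂ ℝⁿ a bounded domain, and for j = 1,…,k let h_j be a downward-pointing singular F-harmonic of finite type at x_j ∈ Ω. Let v and w be upper semicontinuous [−∞,∞)-valued functions on Ω̄, with v F-subharmonic and w F̃-subharmonic on Ω ∖ {x₁,…,x_k}, and suppose for each j that liminf_{x→x_j} (v(x) − v(x_j))/(h_j(x) − h_j(x_j)) ≥ 1 and liminf_{x→x_j} (w(x) − w(x_j))/(h_j(x) − h_j(x_j)) ≥ −1. If v + w ≤ 0 on ∂Ω, then v + w ≤ 0 on Ω̄ (where at each x_j the sum v + w is taken to be limsup_{x→x_j} (v(x) + w(x))). -/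
open scoped Topology Classical
open Filter

noncomputable section

variable {n : ℕ}

section DoublingVariables

variable {E : Type*} [NormedAddCommGroup E] [InnerProductSpace ℝ E]

/-- Sup-inf regularisation of the upper envelope of the paraboloids
`t - K / 2 * ‖· - y‖ ^ 2`, `(y, t) ∈ H`. -/
lemma exists_c11_regularization [FiniteDimensional ℝ E] {H : Set (E × ℝ)} (hH : IsCompact H)
    (hne : H.Nonempty) {K : ℝ} (hK : 0 < K) :
    ∃ (f : E → ℝ) (q : E → E),
      (∀ y t, (y, t) ∈ H → ∀ x, t - K / 2 * ‖x - y‖ ^ 2 ≤ f x) ∧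
      (∀ x h, |f (x + h) - f x - inner ℝ (q x) h| ≤ K * ‖h‖ ^ 2) ∧
      (∀ x p b, (∀ y t, (y, t) ∈ H → ∀ z,
        t - K / 2 * ‖z - y‖ ^ 2 ≤ b + inner ℝ p (z - x) + K * ‖z - x‖ ^ 2) → f x ≤ b) := by
  have : ProperSpace E := FiniteDimensional.proper ℝ E
  set G : E → E × ℝ → ℝ := fun y s => s.2 - K / 3 * ‖y - s.1‖ ^ 2 with hG
  have hGc : Continuous (Function.uncurry G) := by
    simp only [hG, Function.uncurry_def]; fun_prop
  set F : E → ℝ := fun y => sSup (G y '' H) with hF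
  have hFc : Continuous F := hH.continuous_sSup hGc
  have hFbdd : ∀ y, BddAbove (G y '' H) := fun y =>
    (hH.image (hGc.comp (by fun_prop : Continuous fun s : E × ℝ => (y, s)))).bddAbove
  have hle : ∀ y s, s ∈ H → G y s ≤ F y := fun y s hs =>
    le_csSup (hFbdd y) ⟨s, hs, rfl⟩
  have hFle : ∀ y b, (∀ s ∈ H, G y s ≤ b) → F y ≤ b := fun y b hb =>
    csSup_le (hne.image _) (by rintro _ ⟨s, hs, rfl⟩; exact hb s hs)
  obtain ⟨s₀, hs₀⟩ := hne
  -- the infimum is attained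
  have hmin : ∀ x, ∃ y, ∀ z, F y + K * ‖x - y‖ ^ 2 ≤ F z + K * ‖x - z‖ ^ 2 := by
    intro x
    refine Continuous.exists_forall_le' (f := fun y => F y + K * ‖x - y‖ ^ 2) (by fun_prop) x ?_
    set D : ℝ := F x - s₀.2 + 2 * K / 3 * ‖x - s₀.1‖ ^ 2
    have hcoc : ∀ᶠ z in cocompact E, z ∉ Metric.closedBall x (3 * |D| / K + 1) :=
      (isCompact_closedBall x _).compl_mem_cocompact
    filter_upwards [hcoc] with z hz
    have hz1 : 3 * |D| / K + 1 < ‖x - z‖ := by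
      simpa [Metric.mem_closedBall, dist_eq_norm, norm_sub_rev] using hz
    have h1 := hle z s₀ hs₀
    simp only [hG] at h1
    have h2 : ‖z - s₀.1‖ ^ 2 ≤ 2 * ‖x - z‖ ^ 2 + 2 * ‖x - s₀.1‖ ^ 2 := by
      have h3 : ‖z - s₀.1‖ ≤ ‖x - z‖ + ‖x - s₀.1‖ := by
        have := norm_sub_le (x - s₀.1) (x - z)
        simp only [sub_sub_sub_cancel_left] at this
        linarith
      nlinarith [sq_nonneg (‖x - z‖ - ‖x - s₀.1‖), norm_nonneg (z - s₀.1)]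
    have h4 : 3 * |D| / K ≤ ‖x - z‖ ^ 2 := by
      have : 0 ≤ 3 * |D| / K := by positivity
      nlinarith
    have h5 : 3 * |D| ≤ K * ‖x - z‖ ^ 2 := by
      rw [div_le_iff₀ hK] at h4; linarith
    have h6 : D ≤ |D| := le_abs_self D
    have h7 : K / 3 * ‖z - s₀.1‖ ^ 2 ≤ K / 3 * (2 * ‖x - z‖ ^ 2 + 2 * ‖x - s₀.1‖ ^ 2) := by
      gcongr
    simp only [sub_self, norm_zero]
    simp only [D] at h6 h5
    nlinarith
  choose Y hY using hmin
  have hconv : ∀ a b : ℝ, 0 ≤ a → 0 ≤ b → a + b = 1 → ∀ y z,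
      F (a • y + b • z) + K / 3 * ‖a • y + b • z‖ ^ 2 ≤
        a * (F y + K / 3 * ‖y‖ ^ 2) + b * (F z + K / 3 * ‖z‖ ^ 2) := by
    intro a b ha hb hab y z
    have : F (a • y + b • z) ≤ a * (F y + K / 3 * ‖y‖ ^ 2) + b * (F z + K / 3 * ‖z‖ ^ 2)
        - K / 3 * ‖a • y + b • z‖ ^ 2 := by
      apply hFle
      intro s hs
      have h1 := mul_le_mul_of_nonneg_left (hle y s hs) ha
      have h2 := mul_le_mul_of_nonneg_left (hle z s hs) hb
      simp only [hG, norm_sub_sq_real, inner_add_left, inner_smul_left, RCLike.conj_to_real]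
        at h1 h2 ⊢
      obtain rfl : b = 1 - a := by linarith
      nlinarith
    linarith
  set f : E → ℝ := fun x => F (Y x) + K * ‖x - Y x‖ ^ 2 with hf
  have hfle : ∀ x z, f x ≤ F z + K * ‖x - z‖ ^ 2 := fun x z => hY x z
  -- `f + K ‖·‖²` is convex
  have hfconv : ∀ a b : ℝ, 0 ≤ a → 0 ≤ b → a + b = 1 → ∀ y z,
      f (a • y + b • z) + K * ‖a • y + b • z‖ ^ 2 ≤
        a * (f y + K * ‖y‖ ^ 2) + b * (f z + K * ‖z‖ ^ 2) := by
    intro a b ha hb hab y z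
    have h1 := hfle (a • y + b • z) (a • Y y + b • Y z)
    have h2 := hconv a b ha hb hab (Y y) (Y z)
    simp only [hf]
    have h3 : ∀ x y : E, K * ‖x - y‖ ^ 2 + K * ‖x‖ ^ 2 =
        K / 3 * ‖y‖ ^ 2 + K / 6 * ‖y‖ ^ 2 + K / 2 * ‖(2 : ℝ) • x - y‖ ^ 2 := by
      intro x y
      simp only [norm_sub_sq_real, inner_smul_left, norm_smul, RCLike.conj_to_real]
      norm_num
      ring
    have hn : ∀ x y : E, ‖a • x + b • y‖ ^ 2 ≤ a * ‖x‖ ^ 2 + b * ‖y‖ ^ 2 := by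
      intro x y
      have h4 : 0 ≤ a * b * ‖x - y‖ ^ 2 := by positivity
      rw [norm_sub_sq_real] at h4
      rw [norm_add_sq_real, norm_smul, norm_smul, inner_smul_left, inner_smul_right]
      simp only [Real.norm_eq_abs, RCLike.conj_to_real, mul_pow, sq_abs]
      obtain rfl : b = 1 - a := by linarith
      nlinarith
    have h4 := hn (Y y) (Y z)
    have h5 := hn ((2 : ℝ) • y - Y y) ((2 : ℝ) • z - Y z)
    have h6 : (2 : ℝ) • (a • y + b • z) - (a • Y y + b • Y z) =
      a • ((2 : ℝ) • y - Y y) + b • ((2 : ℝ) • z - Y z) := by module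
    have e1 := h3 (a • y + b • z) (a • Y y + b • Y z)
    rw [h6] at e1
    have e2 := h3 y (Y y)
    have e3 := h3 z (Y z)
    have e4 := congrArg (a * ·) e2
    have e5 := congrArg (b * ·) e3
    have h7 := mul_le_mul_of_nonneg_left h4 hK.le
    have h8 := mul_le_mul_of_nonneg_left h5 hK.le
    linarith
  refine ⟨f, fun x => (2 * K) • (x - Y x), ?_, ?_, ?_⟩
  · intro y t hyt x
    have h1 := hle (Y x) _ hyt
    simp only [hG] at h1
    have h2 : 1 / 3 * ‖Y x - y‖ ^ 2 ≤ ‖x - Y x‖ ^ 2 + 1 / 2 * ‖x - y‖ ^ 2 := by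
      have h3 : ‖Y x - y‖ ≤ ‖x - Y x‖ + ‖x - y‖ := by
        have := norm_sub_le (x - y) (x - Y x)
        simp only [sub_sub_sub_cancel_left] at this
        linarith
      nlinarith [sq_nonneg (2 * ‖x - Y x‖ - ‖x - y‖), norm_nonneg (Y x - y)]
    have h3 := mul_le_mul_of_nonneg_left h2 hK.le
    simp only [hf]
    linarith
  · intro x h
    have hup : ∀ h, f (x + h) ≤ f x + inner ℝ ((2 * K) • (x - Y x)) h + K * ‖h‖ ^ 2 := by
      intro h
      have h1 := hfle (x + h) (Y x)
      rw [show x + h - Y x = (x - Y x) + h by abel, norm_add_sq_real] at h1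
      simp only [hf] at h1 ⊢
      rw [inner_smul_left]
      simp only [RCLike.conj_to_real]
      linarith
    have hlow : f x + inner ℝ ((2 * K) • (x - Y x)) h - K * ‖h‖ ^ 2 ≤ f (x + h) := by
      apply le_of_forall_pos_le_add
      intro ε hε
      set τ : ℝ := ε / (2 * K * ‖h‖ ^ 2 + 1)
      have hτ : 0 < τ := by positivity
      have hτε : 2 * K * τ * ‖h‖ ^ 2 ≤ ε := by
        have : τ * (2 * K * ‖h‖ ^ 2 + 1) = ε := by
          simp only [τ]; field_simp
        nlinarith
      have h1 := hfconv (τ / (1 + τ)) (1 / (1 + τ)) (by positivity) (by positivity)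
        (by field_simp; ring) (x + h) (x + (-τ) • h)
      have h2 : (τ / (1 + τ)) • (x + h) + (1 / (1 + τ)) • (x + (-τ) • h) = x := by
        match_scalars <;> field_simp <;> ring
      rw [h2] at h1
      have h3 := hup ((-τ) • h)
      have h4 : (1 + τ) * (f x + K * ‖x‖ ^ 2) ≤ τ * (f (x + h) + K * ‖x + h‖ ^ 2) +
          (f (x + (-τ) • h) + K * ‖x + (-τ) • h‖ ^ 2) := by
        have := mul_le_mul_of_nonneg_left h1 (by positivity : 0 ≤ 1 + τ)
        refine this.trans (le_of_eq ?_)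
        field_simp
      simp only [norm_add_sq_real, inner_smul_right, norm_smul, mul_pow, Real.norm_eq_abs,
        sq_abs] at h3 h4
      have h5 : τ * (f x + inner ℝ ((2 * K) • (x - Y x)) h - K * ‖h‖ ^ 2)
          ≤ τ * (f (x + h) + 2 * K * τ * ‖h‖ ^ 2) := by
        nlinarith
      have := le_of_mul_le_mul_left h5 hτ
      linarith
    rw [abs_le]
    constructor
    · linarith
    · linarith [hup h]
  · intro x p b hb
    have h1 := hfle x (x - (1 / (2 * K)) • p)
    have h2 : F (x - (1 / (2 * K)) • p) ≤ b - 1 / (4 * K) * ‖p‖ ^ 2 := by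
      apply hFle
      rintro ⟨y, t⟩ hyt
      set c := x - (1 / (2 * K)) • p with hc
      have h3 := hb y t hyt (c + (1 / 3 : ℝ) • (y - c))
      have h4 : c + (1 / 3 : ℝ) • (y - c) - y = (-(2 / 3) : ℝ) • (y - c) := by module
      have h5 : c + (1 / 3 : ℝ) • (y - c) - x = (-(1 / (2 * K))) • p + (1 / 3 : ℝ) • (y - c) := by
        rw [hc]; module
      rw [h4, h5] at h3
      simp only [norm_add_sq_real, inner_smul_right, inner_smul_left, inner_add_right, norm_smul,
        mul_pow, Real.norm_eq_abs, sq_abs, RCLike.conj_to_real, real_inner_self_eq_norm_sq] at h3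
      simp only [hG]
      rw [norm_sub_rev c y]
      have e1 : b + (-(1 / (2 * K)) * ‖p‖ ^ 2 + 1 / 3 * inner ℝ p (y - c)) +
          K * ((-(1 / (2 * K))) ^ 2 * ‖p‖ ^ 2 + 2 * (1 / 3 * (-(1 / (2 * K)) * inner ℝ p (y - c))) +
            (1 / 3) ^ 2 * ‖y - c‖ ^ 2) = b - 1 / (4 * K) * ‖p‖ ^ 2 + K / 9 * ‖y - c‖ ^ 2 := by
        field_simp
        ring
      linarith
    have h6 : K * ‖x - (x - (1 / (2 * K)) • p)‖ ^ 2 = 1 / (4 * K) * ‖p‖ ^ 2 := by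
      rw [sub_sub_cancel, norm_smul, mul_pow, Real.norm_eq_abs, sq_abs]
      field_simp
      ring
    linarith

lemma lipschitzWith_of_quadratic_bound {f : E → ℝ} {q : E → E} {K : ℝ} (hK : 0 < K)
    (hfq : ∀ x h, |f (x + h) - f x - inner ℝ (q x) h| ≤ K * ‖h‖ ^ 2) :
    LipschitzWith (6 * K).toNNReal q := by
  apply LipschitzWith.of_dist_le_mul
  intro y x
  rw [Real.coe_toNNReal _ (by positivity), dist_eq_norm, dist_eq_norm]
  set d := q y - q x with hd
  set h := y - x with hh
  rcases eq_or_ne d 0 with h0 | h0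
  · rw [h0, norm_zero]; positivity
  have hdn : 0 < ‖d‖ := norm_pos_iff.2 h0
  set k := (‖h‖ / ‖d‖) • d with hk
  have hkn : ‖k‖ = ‖h‖ := by
    rw [hk, norm_smul, norm_div, norm_norm, norm_norm]; field_simp
  have h1 := hfq x h
  have h2 := hfq y k
  have h3 := hfq x (h + k)
  have hy : x + h = y := by simp [hh]
  rw [← add_assoc, hy] at h3
  rw [hy] at h1
  rw [abs_le] at h1 h2 h3
  rw [inner_add_right] at h3
  have h4 : inner ℝ d k = ‖h‖ * ‖d‖ := by
    rw [hk, inner_smul_right, real_inner_self_eq_norm_sq]; field_simp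
  have h5 : inner ℝ d k = inner ℝ (q y) k - inner ℝ (q x) k := by rw [hd, inner_sub_left]
  have h6 : ‖h + k‖ ^ 2 ≤ 4 * ‖h‖ ^ 2 := by
    have := norm_add_le h k
    rw [hkn] at this
    nlinarith [norm_nonneg (h + k)]
  have h7 := mul_le_mul_of_nonneg_left h6 hK.le
  rw [hkn] at h2
  have h8 : ‖h‖ * ‖d‖ ≤ ‖h‖ * (6 * K * ‖h‖) := by nlinarith
  rcases (norm_nonneg h).eq_or_lt with h9 | h9
  · exfalso
    have hz : h = 0 := norm_eq_zero.1 h9.symm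
    have : y = x := sub_eq_zero.1 hz
    exact h0 (by rw [hd, this, sub_self])
  · exact le_of_mul_le_mul_left h8 h9

lemma hasFDerivAt_of_quadratic_bound {f : E → ℝ} {q : E → E} {K : ℝ}
    (hfq : ∀ x h, |f (x + h) - f x - inner ℝ (q x) h| ≤ K * ‖h‖ ^ 2) (x : E) :
    HasFDerivAt f (innerSL ℝ (q x)) x := by
  rw [hasFDerivAt_iff_isLittleO_nhds_zero]
  have h1 : (fun h => f (x + h) - f x - innerSL ℝ (q x) h) =O[𝓝 0] fun h : E => ‖h‖ ^ 2 := by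
    apply Asymptotics.IsBigO.of_bound K
    filter_upwards with h
    simpa using hfq x h
  refine h1.trans_isLittleO ?_
  have := Asymptotics.isLittleO_norm_pow_id (E' := E) (n := 2) (by norm_num)
  simpa using this

lemma eventually_taylor_two {f : E → ℝ} {q : E → E} {K : ℝ}
    (hfq : ∀ x h, |f (x + h) - f x - inner ℝ (q x) h| ≤ K * ‖h‖ ^ 2) {x : E} {L : E →L[ℝ] E}
    (hL : HasFDerivAt q L x) {η : ℝ} (hη : 0 < η) :
    ∀ᶠ h in 𝓝 (0 : E),
      |f (x + h) - f x - inner ℝ (q x) h - 1 / 2 * inner ℝ (L h) h| ≤ η * ‖h‖ ^ 2 := by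
  have h1 := (hasFDerivAt_iff_isLittleO_nhds_zero.1 hL).def hη
  obtain ⟨ε, hε, hball⟩ := Metric.eventually_nhds_iff_ball.1 h1
  filter_upwards [Metric.ball_mem_nhds (0 : E) hε] with h hh
  have hder : ∀ t : ℝ, HasDerivAt
      (fun t : ℝ => f (x + t • h) - t * inner ℝ (q x) h - t ^ 2 * (1 / 2 * inner ℝ (L h) h))
      (inner ℝ (q (x + t • h)) h - inner ℝ (q x) h - t * inner ℝ (L h) h) t := by
    intro t
    have h2 : HasDerivAt (fun t : ℝ => x + t • h) h t := by
      simpa using ((hasDerivAt_id t).smul_const h).const_add x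
    have h3 := (hasFDerivAt_of_quadratic_bound hfq (x + t • h)).comp_hasDerivAt t h2
    have h4 := (hasDerivAt_id t).mul_const (inner ℝ (q x) h)
    have h5 := ((hasDerivAt_id t).pow 2).mul_const (1 / 2 * inner ℝ (L h) h)
    refine ((h3.sub h4).sub h5).congr_deriv ?_
    simp
    ring
  have h2 := norm_image_sub_le_of_norm_deriv_le_segment_01' (C := η * ‖h‖ ^ 2)
    (fun t _ => (hder t).hasDerivWithinAt) (by
      rintro t ⟨ht0, ht1⟩
      have h3 : t • h ∈ Metric.ball (0 : E) ε := by
        rw [mem_ball_zero_iff] at hh ⊢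
        rw [norm_smul, Real.norm_eq_abs, abs_of_nonneg ht0]
        nlinarith [norm_nonneg h]
      have h4 := hball _ h3
      have h5 : inner ℝ (q (x + t • h)) h - inner ℝ (q x) h - t * inner ℝ (L h) h =
          inner ℝ (q (x + t • h) - q x - L (t • h)) h := by
        rw [inner_sub_left, inner_sub_left, map_smul, inner_smul_left]; simp
      rw [h5]
      refine (norm_inner_le_norm _ _).trans ?_
      rw [norm_smul, Real.norm_eq_abs, abs_of_nonneg ht0] at h4
      calc _ ≤ η * (t * ‖h‖) * ‖h‖ := by gcongr
        _ ≤ η * (1 * ‖h‖) * ‖h‖ := by gcongr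
        _ = _ := by ring)
  rw [Real.norm_eq_abs] at h2
  convert h2 using 2
  simp
  ring

lemma eq_zero_of_inner_le_sq {d : E} {K : ℝ} (h : ∀ k : E, inner ℝ d k ≤ K * ‖k‖ ^ 2) :
    d = 0 := by
  by_contra hd
  have hdn : 0 < ‖d‖ := norm_pos_iff.2 hd
  have h1 := h ((1 / (|K| + 1)) • d)
  rw [inner_smul_right, real_inner_self_eq_norm_sq, norm_smul, mul_pow, Real.norm_eq_abs,
    sq_abs] at h1
  have h2 : K ≤ |K| := le_abs_self K
  have h3 : (0 : ℝ) < |K| + 1 := by positivity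
  have h4 : (|K| + 1) ^ 2 * (1 / (|K| + 1) * ‖d‖ ^ 2) ≤
      (|K| + 1) ^ 2 * (K * ((1 / (|K| + 1)) ^ 2 * ‖d‖ ^ 2)) :=
    mul_le_mul_of_nonneg_left h1 (by positivity)
  have h5 : (|K| + 1) ^ 2 * (1 / (|K| + 1) * ‖d‖ ^ 2) = (|K| + 1) * ‖d‖ ^ 2 := by
    field_simp
  have h6 : (|K| + 1) ^ 2 * (K * ((1 / (|K| + 1)) ^ 2 * ‖d‖ ^ 2)) = K * ‖d‖ ^ 2 := by
    field_simp
  rw [h5, h6] at h4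
  have : 0 < ‖d‖ ^ 2 := by positivity
  nlinarith

/-- Localisation of the maximum points in the doubling of variables. -/
lemma exists_doubling_localization {H₁ H₂ : Set (E × ℝ)} (hH₁ : IsCompact H₁)
    (hH₂ : IsCompact H₂) (x₀ : E) (m : ℝ)
    (hle : ∀ y t s, (y, t) ∈ H₁ → (y, s) ∈ H₂ → t + s ≤ m)
    (heq : ∀ y t s, (y, t) ∈ H₁ → (y, s) ∈ H₂ → t + s = m → y = x₀) {η : ℝ} (hη : 0 < η) :
    ∃ K > 0, ∃ δ > 0, ∀ p : E, ‖p‖ < δ → ∀ x y t z s, (y, t) ∈ H₁ → (z, s) ∈ H₂ →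
      m ≤ t + s - K / 2 * ‖x - y‖ ^ 2 - K / 2 * ‖x - z‖ ^ 2 - inner ℝ p (x - x₀) →
      ‖y - x₀‖ < η ∧ ‖z - x₀‖ < η ∧ m - η < t + s := by
  set T : Set ((E × ℝ) × (E × ℝ)) := (H₁ ×ˢ H₂) ∩
    {a | η ≤ ‖a.1.1 - x₀‖ ∨ η ≤ ‖a.2.1 - x₀‖ ∨ a.1.2 + a.2.2 ≤ m - η} with hT
  have hTc : IsCompact T := by
    refine (hH₁.prod hH₂).inter_right ?_
    have c1 : IsClosed {a : (E × ℝ) × (E × ℝ) | η ≤ ‖a.1.1 - x₀‖} :=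
      isClosed_le (by fun_prop) (by fun_prop)
    have c2 : IsClosed {a : (E × ℝ) × (E × ℝ) | η ≤ ‖a.2.1 - x₀‖} :=
      isClosed_le (by fun_prop) (by fun_prop)
    have c3 : IsClosed {a : (E × ℝ) × (E × ℝ) | a.1.2 + a.2.2 ≤ m - η} :=
      isClosed_le (by fun_prop) (by fun_prop)
    exact c1.union (c2.union c3)
  obtain ⟨κ, hκ, hκT⟩ : ∃ κ > 0, ∀ a ∈ T,
      κ < max (m - (a.1.2 + a.2.2)) (‖a.1.1 - a.2.1‖ ^ 2) := by
    have := hTc.exists_forall_le' (f := fun a : (E × ℝ) × (E × ℝ) =>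
      max (m - (a.1.2 + a.2.2)) (‖a.1.1 - a.2.1‖ ^ 2)) (by fun_prop) (a := 0) (by
        rintro ⟨⟨y, t⟩, ⟨z, s⟩⟩ ⟨⟨h1, h2⟩, h3⟩
        simp only at h1 h2 h3 ⊢
        rcases eq_or_ne y z with rfl | hyz
        · apply lt_max_of_lt_left
          rcases (hle y t s h1 h2).lt_or_eq with h4 | h4
          · linarith
          · have h5 := heq y t s h1 h2 h4
            subst h5
            simp only [sub_self, norm_zero, Set.mem_ofPred_eq] at h3
            rcases h3 with h3 | h3 | h3 <;> linarith
        · apply lt_max_of_lt_right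
          have := norm_pos_iff.2 (sub_ne_zero.2 hyz)
          positivity)
    obtain ⟨a', h1, h2⟩ := this
    exact ⟨a' / 2, by linarith, fun a ha => by linarith [h2 a ha]⟩
  obtain ⟨R, hR⟩ := hH₁.isBounded.subset_closedBall (x₀, (0 : ℝ))
  obtain ⟨R', hR'⟩ := hH₂.isBounded.subset_closedBall (x₀, (0 : ℝ))
  set D := |R| + |R'| + 1
  have hD : 1 ≤ D := by simp only [D]; linarith [abs_nonneg R, abs_nonneg R']
  have hb1 : ∀ y t, (y, t) ∈ H₁ → ‖y - x₀‖ ≤ D ∧ t ≤ D := by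
    intro y t h
    have := hR h
    rw [Metric.mem_closedBall, Prod.dist_eq, max_le_iff, dist_eq_norm, Real.dist_eq,
      sub_zero] at this
    constructor <;> simp only [D] <;>
      linarith [abs_nonneg R', le_abs_self R, le_abs_self t, this.1, this.2]
  have hb2 : ∀ y t, (y, t) ∈ H₂ → ‖y - x₀‖ ≤ D ∧ t ≤ D := by
    intro y t h
    have := hR' h
    rw [Metric.mem_closedBall, Prod.dist_eq, max_le_iff, dist_eq_norm, Real.dist_eq,
      sub_zero] at this
    constructor <;> simp only [D] <;>
      linarith [abs_nonneg R, le_abs_self R', le_abs_self t, this.1, this.2]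
  set K := 1 + 8 * (2 * D + |m| + 1 + D) / κ with hKdef
  have hK1 : 1 ≤ K := by
    have : 0 ≤ 8 * (2 * D + |m| + 1 + D) / κ := by positivity
    linarith
  have hKκ : 8 * (2 * D + |m| + 1 + D) ≤ K * κ := by
    rw [hKdef, add_mul, div_mul_cancel₀ _ hκ.ne']; linarith
  refine ⟨K, by linarith, min 1 (κ / (1 + D)), by positivity, ?_⟩
  intro p hp x y t z s h1 h2 h3
  by_contra hcon
  have hmem : ((y, t), (z, s)) ∈ T := by
    refine ⟨⟨h1, h2⟩, ?_⟩
    simp only [Set.mem_ofPred_eq]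
    by_contra h4
    push Not at h4
    exact hcon h4
  have hp1 : ‖p‖ < 1 := hp.trans_le (min_le_left _ _)
  have hp2 : ‖p‖ * (1 + D) < κ := by
    rw [← lt_div_iff₀ (by linarith)]; exact hp.trans_le (min_le_right _ _)
  have h4 : -inner ℝ p (x - x₀) ≤ ‖p‖ * (‖x - y‖ + D) := by
    refine (neg_le_abs _).trans ((abs_real_inner_le_norm _ _).trans ?_)
    gcongr
    calc ‖x - x₀‖ = ‖(x - y) + (y - x₀)‖ := by congr 1; abel
      _ ≤ _ := (norm_add_le _ _).trans (by linarith [(hb1 y t h1).1])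
  have h5 : ‖p‖ * ‖x - y‖ ≤ K / 4 * ‖x - y‖ ^ 2 + ‖p‖ := by
    have : ‖x - y‖ ≤ ‖x - y‖ ^ 2 / 4 + 1 := by nlinarith [sq_nonneg (‖x - y‖ / 2 - 1)]
    calc ‖p‖ * ‖x - y‖ ≤ ‖p‖ * (‖x - y‖ ^ 2 / 4 + 1) := by gcongr
      _ = ‖p‖ * (‖x - y‖ ^ 2 / 4) + ‖p‖ := by ring
      _ ≤ K * (‖x - y‖ ^ 2 / 4) + ‖p‖ := by gcongr; linarith
      _ = _ := by ring
  have h6 : ‖y - z‖ ^ 2 ≤ 2 * ‖x - y‖ ^ 2 + 2 * ‖x - z‖ ^ 2 := by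
    have : ‖y - z‖ ≤ ‖x - y‖ + ‖x - z‖ := by
      have := norm_sub_le (x - z) (x - y)
      simp only [sub_sub_sub_cancel_left] at this
      linarith
    nlinarith [sq_nonneg (‖x - y‖ - ‖x - z‖), norm_nonneg (y - z)]
  have h7 : K * ‖y - z‖ ^ 2 ≤ K * (2 * ‖x - y‖ ^ 2 + 2 * ‖x - z‖ ^ 2) := by gcongr
  have h8 : m ≤ t + s - K / 8 * ‖y - z‖ ^ 2 + ‖p‖ * (1 + D) := by
    have : 0 ≤ K * ‖x - z‖ ^ 2 := by positivity
    linarith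
  have h9 := hκT _ hmem
  simp only [lt_max_iff] at h9
  rcases h9 with h9 | h9
  · have : 0 ≤ K / 8 * ‖y - z‖ ^ 2 := by positivity
    linarith
  · have h10 : K * κ < K * ‖y - z‖ ^ 2 := by gcongr
    have h11 : ‖p‖ * (1 + D) ≤ 1 * (1 + D) := by gcongr
    linarith [(hb1 y t h1).2, (hb2 z s h2).2, neg_le_abs m]

lemma exists_doubling_maximum [FiniteDimensional ℝ E] {H₁ H₂ : Set (E × ℝ)} (hH₁ : IsCompact H₁)
    (hH₂ : IsCompact H₂) {x₀ : E} {t₀ s₀ : ℝ} (h₁ : (x₀, t₀) ∈ H₁) (h₂ : (x₀, s₀) ∈ H₂)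
    {K : ℝ} (hK : 0 < K) (p : E) :
    ∃ x y t z s, (y, t) ∈ H₁ ∧ (z, s) ∈ H₂ ∧ ∀ x' y' t' z' s', (y', t') ∈ H₁ → (z', s') ∈ H₂ →
      t' + s' - K / 2 * ‖x' - y'‖ ^ 2 - K / 2 * ‖x' - z'‖ ^ 2 - inner ℝ p (x' - x₀) ≤
      t + s - K / 2 * ‖x - y‖ ^ 2 - K / 2 * ‖x - z‖ ^ 2 - inner ℝ p (x - x₀) := by
  have : ProperSpace E := FiniteDimensional.proper ℝ E
  obtain ⟨R, hR⟩ := (hH₁.union hH₂).isBounded.subset_closedBall (x₀, (0 : ℝ))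
  have hb : ∀ y t, (y, t) ∈ H₁ ∪ H₂ → ‖y - x₀‖ ≤ |R| ∧ t ≤ |R| := by
    intro y t h
    have := hR h
    rw [Metric.mem_closedBall, Prod.dist_eq, max_le_iff, dist_eq_norm, Real.dist_eq,
      sub_zero] at this
    exact ⟨this.1.trans (le_abs_self R), (le_abs_self t).trans (this.2.trans (le_abs_self R))⟩
  set C := 2 * |R| - (t₀ + s₀) + ‖p‖ * |R|
  set ρ := |R| + (1 + 2 * (‖p‖ + |C|) / K) with hρ
  have hρ0 : 0 ≤ ρ := by positivity
  set Φ : E × ((E × ℝ) × (E × ℝ)) → ℝ := fun a => a.2.1.2 + a.2.2.2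
    - K / 2 * ‖a.1 - a.2.1.1‖ ^ 2 - K / 2 * ‖a.1 - a.2.2.1‖ ^ 2 - inner ℝ p (a.1 - x₀) with hΦ
  have hc : Continuous Φ := by fun_prop
  have hmem₀ : (x₀, ((x₀, t₀), (x₀, s₀))) ∈ Metric.closedBall x₀ ρ ×ˢ (H₁ ×ˢ H₂) :=
    ⟨Metric.mem_closedBall_self hρ0, h₁, h₂⟩
  obtain ⟨⟨x, ⟨⟨y, t⟩, ⟨z, s⟩⟩⟩, ⟨-, hy, hz⟩, hmax⟩ :=
    ((isCompact_closedBall x₀ ρ).prod (hH₁.prod hH₂)).exists_isMaxOn ⟨_, hmem₀⟩ hc.continuousOn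
  refine ⟨x, y, t, z, s, hy, hz, fun x' y' t' z' s' h1 h2 => ?_⟩
  by_cases hx' : x' ∈ Metric.closedBall x₀ ρ
  · exact hmax (a := (x', ((y', t'), (z', s')))) ⟨hx', h1, h2⟩
  · have h3 := hmax hmem₀
    simp only [hΦ, Set.mem_ofPred_eq, sub_self, norm_zero, inner_zero_right] at h3
    refine le_trans ?_ h3
    rw [Metric.mem_closedBall, dist_eq_norm, not_le] at hx'
    have h4 := hb y' t' (Or.inl h1)
    have h5 := hb z' s' (Or.inr h2)
    have h6 : ‖x' - x₀‖ ≤ ‖x' - y'‖ + |R| := by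
      calc ‖x' - x₀‖ = ‖(x' - y') + (y' - x₀)‖ := by congr 1; abel
        _ ≤ _ := (norm_add_le _ _).trans (by linarith)
    set a := ‖x' - y'‖
    have h7 : 1 + 2 * (‖p‖ + |C|) / K ≤ a := by linarith
    have h8 : K + 2 * (‖p‖ + |C|) ≤ K * a := by
      have := mul_le_mul_of_nonneg_left h7 hK.le
      rw [mul_add, mul_div_cancel₀ _ hK.ne'] at this
      linarith
    have h9 : -inner ℝ p (x' - x₀) ≤ ‖p‖ * (a + |R|) := by
      refine (neg_le_abs _).trans ((abs_real_inner_le_norm _ _).trans ?_)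
      gcongr
    have h10 : |C| ≤ a * (K * a / 2 - ‖p‖) := by
      have h11 : 1 ≤ a := by
        have : 0 ≤ 2 * (‖p‖ + |C|) / K := by positivity
        linarith
      have h12 : |C| ≤ K * a / 2 - ‖p‖ := by linarith
      have := abs_nonneg C
      nlinarith
    have h11 : 0 ≤ K / 2 * ‖x' - z'‖ ^ 2 := by positivity
    have h12 := le_abs_self C
    simp only [C] at h12 h10
    nlinarith

lemma sq_norm_sub_le_expand (ξ x z : E) :
    ‖ξ - z‖ ^ 2 = ‖x - z‖ ^ 2 + 2 * inner ℝ (x - z) (ξ - x) + ‖ξ - x‖ ^ 2 := by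
  rw [← norm_add_sq_real]; congr 2; abel

/-- A form of the theorem on sums: near a strict maximum of the sum of two upper semicontinuous
functions, given by compact subsets of their hypographs, both functions are touched from above
by quadratic functions whose Hessians add up to an almost nonpositive form. -/
theorem exists_quadratic_contacts [FiniteDimensional ℝ E] [MeasurableSpace E] [BorelSpace E]
    {H₁ H₂ : Set (E × ℝ)} (hH₁ : IsCompact H₁) (hH₂ : IsCompact H₂) {x₀ : E} {t₀ s₀ : ℝ}
    (h₁ : (x₀, t₀) ∈ H₁) (h₂ : (x₀, s₀) ∈ H₂)
    (hle : ∀ y t s, (y, t) ∈ H₁ → (y, s) ∈ H₂ → t + s ≤ t₀ + s₀)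
    (heq : ∀ y t s, (y, t) ∈ H₁ → (y, s) ∈ H₂ → t + s = t₀ + s₀ → y = x₀)
    {η : ℝ} (hη : 0 < η) :
    ∃ (y : E) (t : ℝ) (z : E) (s : ℝ) (p₁ p₂ : E) (L₁ L₂ : E →L[ℝ] E),
      (y, t) ∈ H₁ ∧ (z, s) ∈ H₂ ∧ ‖y - x₀‖ < η ∧ ‖z - x₀‖ < η ∧ t₀ + s₀ - η < t + s ∧
      (∀ᶠ h in 𝓝 (0 : E), ∀ t', (y + h, t') ∈ H₁ →
        t' ≤ t + inner ℝ p₁ h + 1 / 2 * inner ℝ (L₁ h) h + η * ‖h‖ ^ 2) ∧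
      (∀ᶠ h in 𝓝 (0 : E), ∀ s', (z + h, s') ∈ H₂ →
        s' ≤ s + inner ℝ p₂ h + 1 / 2 * inner ℝ (L₂ h) h + η * ‖h‖ ^ 2) ∧
      ∀ h, inner ℝ (L₁ h) h + inner ℝ (L₂ h) h ≤ 4 * η * ‖h‖ ^ 2 := by
  obtain ⟨K, hK, δ, hδ, hloc⟩ := exists_doubling_localization hH₁ hH₂ x₀ (t₀ + s₀) hle heq hη
  obtain ⟨f, q, hfl, hfq, hfu⟩ := exists_c11_regularization hH₁ ⟨_, h₁⟩ hK
  obtain ⟨g, r, hgl, hgr, hgu⟩ := exists_c11_regularization hH₂ ⟨_, h₂⟩ hK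
  have hq := lipschitzWith_of_quadratic_bound hK hfq
  have hr := lipschitzWith_of_quadratic_bound hK hgr
  let μ : MeasureTheory.Measure E := MeasureTheory.Measure.hausdorffMeasure (Module.finrank ℝ E)
  have hμ : μ.IsAddHaarMeasure := MeasureTheory.isAddHaarMeasure_hausdorffMeasure
  have hae : ∀ᵐ x ∂μ, DifferentiableAt ℝ q x ∧ DifferentiableAt ℝ r x :=
    hq.ae_differentiableAt.and hr.ae_differentiableAt
  set N := {x | ¬(DifferentiableAt ℝ q x ∧ DifferentiableAt ℝ r x)}
  have hN : μ N = 0 := hae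
  have hQN : μ ((fun x => q x + r x) '' N) = 0 := by
    have := (hq.add hr).hausdorffMeasure_image_le (d := Module.finrank ℝ E) (Nat.cast_nonneg _) N
    change μ _ ≤ _ * μ N at this
    rw [hN, mul_zero] at this
    exact le_antisymm this bot_le
  obtain ⟨p, hpδ, hpN⟩ : ∃ p ∈ Metric.ball (0 : E) δ, p ∉ (fun x => q x + r x) '' N := by
    by_contra hcon
    push Not at hcon
    exact (Metric.measure_ball_pos μ (0 : E) hδ).ne' (MeasureTheory.measure_mono_null hcon hQN)
  rw [mem_ball_zero_iff] at hpδ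
  obtain ⟨x, y, t, z, s, hy, hz, hmax⟩ := exists_doubling_maximum hH₁ hH₂ h₁ h₂ hK p
  set m := t + s - K / 2 * ‖x - y‖ ^ 2 - K / 2 * ‖x - z‖ ^ 2 - inner ℝ p (x - x₀) with hm
  have hm0 : t₀ + s₀ ≤ m := by simpa using hmax x₀ x₀ t₀ x₀ s₀ h₁ h₂
  obtain ⟨hyη, hzη, htsη⟩ := hloc p hpδ x y t z s hy hz hm0
  have hinner : ∀ ξ x : E, inner ℝ p (ξ - x₀) = inner ℝ p (x - x₀) + inner ℝ p (ξ - x) := by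
    intro ξ x
    rw [← inner_add_right]; congr 1; abel
  have hf2 : ∀ ξ z' s', (z', s') ∈ H₂ →
      f ξ ≤ m + inner ℝ p (ξ - x₀) - s' + K / 2 * ‖ξ - z'‖ ^ 2 := by
    intro ξ z' s' hz'
    refine hfu ξ (p + K • (ξ - z')) _ fun y' t' hy' ζ => ?_
    have e1 := hmax ζ y' t' z' s' hy' hz'
    have e2 := sq_norm_sub_le_expand ζ ξ z'
    have e3 := hinner ζ ξ
    have e4 : 0 ≤ K / 2 * ‖ζ - ξ‖ ^ 2 := by positivity
    rw [inner_add_left, inner_smul_left, RCLike.conj_to_real]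
    rw [e2, e3] at e1
    linarith
  have hfg : ∀ ξ, f ξ + g ξ ≤ m + inner ℝ p (ξ - x₀) := by
    intro ξ
    have : g ξ ≤ m + inner ℝ p (ξ - x₀) - f ξ := by
      refine hgu ξ (p - q ξ) _ fun z' s' hz' ζ => ?_
      have e1 := hf2 ζ z' s' hz'
      have e2 := (abs_le.1 (hfq ξ (ζ - ξ))).1
      rw [add_sub_cancel] at e2
      have e3 := hinner ζ ξ
      rw [inner_sub_left]
      linarith
    linarith
  have hfx : f x = t - K / 2 * ‖x - y‖ ^ 2 := by
    have e1 := hfl y t hy x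
    have e2 := hgl z s hz x
    have e3 := hfg x
    linarith
  have hgx : g x = s - K / 2 * ‖x - z‖ ^ 2 := by
    have e1 := hfl y t hy x
    have e2 := hgl z s hz x
    have e3 := hfg x
    linarith
  have hmaxh : ∀ h, f (x + h) + g (x + h) ≤ f x + g x + inner ℝ p h := by
    intro h
    have e1 := hfg (x + h)
    rw [hinner (x + h) x, add_sub_cancel_left] at e1
    linarith
  have hgrad : q x + r x - p = 0 := by
    apply eq_zero_of_inner_le_sq (K := 2 * K)
    intro h
    have e1 := (abs_le.1 (hfq x h)).1
    have e2 := (abs_le.1 (hgr x h)).1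
    have e3 := hmaxh h
    rw [inner_sub_left, inner_add_left]
    linarith
  have hxN : x ∉ N := fun hx => hpN ⟨x, hx, sub_eq_zero.1 hgrad⟩
  simp only [N, Set.mem_ofPred_eq, not_not] at hxN
  have T1 := eventually_taylor_two hfq hxN.1.hasFDerivAt hη
  have T2 := eventually_taylor_two hgr hxN.2.hasFDerivAt hη
  refine ⟨y, t, z, s, q x, r x, fderiv ℝ q x, fderiv ℝ r x, hy, hz, hyη, hzη, htsη, ?_, ?_, ?_⟩
  · filter_upwards [T1] with h hh t' ht'
    have e1 := hfl _ _ ht' (x + h)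
    rw [add_sub_add_right_eq_sub] at e1
    linarith [(abs_le.1 hh).2]
  · filter_upwards [T2] with h hh s' hs'
    have e1 := hgl _ _ hs' (x + h)
    rw [add_sub_add_right_eq_sub] at e1
    linarith [(abs_le.1 hh).2]
  · intro h
    have hlim : Tendsto (fun τ : ℝ => τ • h) (𝓝[>] 0) (𝓝 0) := by
      have : Tendsto (fun τ : ℝ => τ • h) (𝓝 0) (𝓝 ((0 : ℝ) • h)) :=
        (continuous_id.smul continuous_const).tendsto 0
      rw [zero_smul] at this
      exact this.mono_left nhdsWithin_le_nhds
    obtain ⟨τ, ⟨e1, e2⟩, hτ⟩ :=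
      ((hlim.eventually (T1.and T2)).and self_mem_nhdsWithin).exists
    have hτ0 : (0 : ℝ) < τ := hτ
    have e3 := hmaxh (τ • h)
    have e4 : inner ℝ (q x) (τ • h) + inner ℝ (r x) (τ • h) = inner ℝ p (τ • h) := by
      rw [← inner_add_left, sub_eq_zero.1 hgrad]
    have e5 : 1 / 2 * inner ℝ (fderiv ℝ q x (τ • h)) (τ • h) +
        1 / 2 * inner ℝ (fderiv ℝ r x (τ • h)) (τ • h) ≤ 2 * η * ‖τ • h‖ ^ 2 := by
      linarith [(abs_le.1 e1).1, (abs_le.1 e2).1]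
    simp only [map_smul, inner_smul_left, inner_smul_right, RCLike.conj_to_real, norm_smul,
      mul_pow, Real.norm_eq_abs, sq_abs] at e5
    have e6 : 0 < τ ^ 2 / 2 := by positivity
    refine le_of_mul_le_mul_left ?_ e6
    linarith

end DoublingVariables

/-- The symmetric matrix of the quadratic form `h ↦ ⟪M h, h⟫`. -/
def quadMat (M : EucSp n →L[ℝ] EucSp n) : SymMat n :=
  ⟨Matrix.of fun i j =>
    (inner ℝ (M (EuclideanSpace.single i 1)) (EuclideanSpace.single j 1) +
      inner ℝ (M (EuclideanSpace.single j 1)) (EuclideanSpace.single i 1)) / 2, by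
    rw [selfAdjoint.mem_iff]
    ext i j
    simp [Matrix.star_apply, add_comm]⟩

lemma quadMat_add (M N : EucSp n →L[ℝ] EucSp n) : quadMat (M + N) = quadMat M + quadMat N := by
  ext i j
  simp only [quadMat, AddSubgroup.coe_add, Matrix.add_apply, Matrix.of_apply, inner_add_left,
    add_apply]
  ring

lemma quadMat_neg (M : EucSp n →L[ℝ] EucSp n) : quadMat (-M) = -quadMat M := by
  ext i j
  simp only [quadMat, AddSubgroup.coe_neg, Matrix.neg_apply, Matrix.of_apply, inner_neg_left,
    neg_apply]
  ring

lemma euclidean_eq_sum_single (x : EucSp n) :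
    x = ∑ i, x i • EuclideanSpace.single i (1 : ℝ) := by
  ext j
  simp [Finset.sum_apply, Pi.single_apply]

lemma dotProduct_quadMat_mulVec (M : EucSp n →L[ℝ] EucSp n) (x : Fin n → ℝ) :
    star x ⬝ᵥ ((quadMat M : Matrix (Fin n) (Fin n) ℝ).mulVec x) =
      inner ℝ (M (WithLp.toLp 2 x)) (WithLp.toLp 2 x) := by
  have h1 : inner ℝ (M (WithLp.toLp 2 x)) (WithLp.toLp 2 x) = ∑ i, ∑ j, x i * x j *
      inner ℝ (M (EuclideanSpace.single i 1)) (EuclideanSpace.single j 1) := by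
    conv_lhs => rw [euclidean_eq_sum_single (WithLp.toLp 2 x)]
    simp only [map_sum, map_smul, sum_inner, inner_sum, inner_smul_left, inner_smul_right,
      RCLike.conj_to_real, Finset.mul_sum]
    rw [Finset.sum_comm]
    refine Finset.sum_congr rfl fun i _ => Finset.sum_congr rfl fun j _ => ?_
    ring
  have h2 : inner ℝ (M (WithLp.toLp 2 x)) (WithLp.toLp 2 x) = ∑ i, ∑ j, x i * x j *
      inner ℝ (M (EuclideanSpace.single j 1)) (EuclideanSpace.single i 1) := by
    rw [h1, Finset.sum_comm]
    simp only [mul_comm (x _) (x _)]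
  have h3 : star x ⬝ᵥ ((quadMat M : Matrix (Fin n) (Fin n) ℝ).mulVec x) =
      ((∑ i, ∑ j, x i * x j *
        inner ℝ (M (EuclideanSpace.single i 1)) (EuclideanSpace.single j 1)) +
      ∑ i, ∑ j, x i * x j *
        inner ℝ (M (EuclideanSpace.single j 1)) (EuclideanSpace.single i 1)) / 2 := by
    simp only [dotProduct, Matrix.mulVec, quadMat, Matrix.of_apply, star_trivial,
      Finset.mul_sum, ← Finset.sum_add_distrib, Finset.sum_div]
    refine Finset.sum_congr rfl fun i _ => Finset.sum_congr rfl fun j _ => ?_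
    ring
  rw [h3, ← h1, ← h2]
  ring

lemma add_quadMat_mem_interior (F : ConeSubequation n) {A : SymMat n} (hA : A ∈ F.carrier)
    {M : EucSp n →L[ℝ] EucSp n} {κ : ℝ} (hκ : 0 < κ)
    (hM : ∀ h, κ * ‖h‖ ^ 2 ≤ inner ℝ (M h) h) : A + quadMat M ∈ interior F.carrier := by
  rw [mem_interior]
  refine ⟨{N | ∑ i, ∑ j, |(N : Matrix (Fin n) (Fin n) ℝ) i j -
    (A + quadMat M : SymMat n).1 i j| < κ}, ?_, ?_, by simpa using hκ⟩
  · intro N hN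
    have h1 : N = A + (N - A) := by abel
    rw [h1]
    apply F.f1 _ hA
    rw [Matrix.posSemidef_iff_dotProduct_mulVec]
    refine ⟨(N - A).2, fun x => ?_⟩
    set E : Matrix (Fin n) (Fin n) ℝ := N.1 - (A + quadMat M : SymMat n).1 with hE
    have h2 : ((N - A : SymMat n) : Matrix (Fin n) (Fin n) ℝ) = E + (quadMat M).1 := by
      simp only [hE, AddSubgroup.coe_sub, AddSubgroup.coe_add]
      abel
    rw [h2, Matrix.add_mulVec, dotProduct_add, dotProduct_quadMat_mulVec]
    have h3 := hM (WithLp.toLp 2 x)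
    set X : EucSp n := WithLp.toLp 2 x
    have h4 : -(κ * ‖X‖ ^ 2) ≤ star x ⬝ᵥ E.mulVec x := by
      have h5 : |star x ⬝ᵥ E.mulVec x| ≤ ∑ i, ∑ j, |E i j| * ‖X‖ ^ 2 := by
        simp only [dotProduct, Matrix.mulVec, star_trivial, Finset.mul_sum]
        refine (Finset.abs_sum_le_sum_abs _ _).trans (Finset.sum_le_sum fun i _ => ?_)
        refine (Finset.abs_sum_le_sum_abs _ _).trans (Finset.sum_le_sum fun j _ => ?_)
        have hi : |x i| ≤ ‖X‖ := PiLp.norm_apply_le X i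
        have hj : |x j| ≤ ‖X‖ := PiLp.norm_apply_le X j
        rw [abs_mul, abs_mul]
        calc |x i| * (|E i j| * |x j|) ≤ ‖X‖ * (|E i j| * ‖X‖) := by gcongr
          _ = _ := by ring
      simp only [← Finset.sum_mul] at h5
      have h6 : ∑ i, ∑ j, |E i j| < κ := hN
      have h7 := (abs_le.1 h5).1
      have h8 : (∑ i, ∑ j, |E i j|) * ‖X‖ ^ 2 ≤ κ * ‖X‖ ^ 2 := by gcongr
      linarith
    linarith
  · refine isOpen_lt ?_ continuous_const
    refine continuous_finsetSum _ fun i _ => continuous_finsetSum _ fun j _ => ?_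
    exact ((continuous_subtype_val.matrix_elem i j).sub continuous_const).abs

lemma hessMatrix_quadratic_s7 (b : ℝ) (p : EucSp n) (M : EucSp n →L[ℝ] EucSp n) (x₀ : EucSp n) :
    ContDiff ℝ 2 (fun y => b + inner ℝ p (y - x₀) + 1 / 2 * inner ℝ (M (y - x₀)) (y - x₀)) ∧
    hessMatrix (fun y => b + inner ℝ p (y - x₀) + 1 / 2 * inner ℝ (M (y - x₀)) (y - x₀)) x₀ =
      quadMat M := by
  set ψ : EucSp n → ℝ :=
    fun y => b + inner ℝ p (y - x₀) + 1 / 2 * inner ℝ (M (y - x₀)) (y - x₀) with hψ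
  have hC : ContDiff ℝ 2 ψ := by
    have h1 : ContDiff ℝ 2 fun y : EucSp n => y - x₀ := contDiff_id.sub contDiff_const
    have h2 : ContDiff ℝ 2 fun y : EucSp n => M (y - x₀) := M.contDiff.comp h1
    exact (contDiff_const.add (contDiff_const.inner ℝ h1)).add
      (contDiff_const.mul (h2.inner ℝ h1))
  refine ⟨hC, ?_⟩
  have hid : ∀ y, HasFDerivAt (fun y : EucSp n => y - x₀) (ContinuousLinearMap.id ℝ _) y :=
    fun y => (hasFDerivAt_id y).sub_const x₀
  have hM : ∀ y, HasFDerivAt (fun y : EucSp n => M (y - x₀)) M y :=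
    fun y => by
      have h := M.hasFDerivAt.comp y (hid y)
      rwa [ContinuousLinearMap.comp_id] at h
  have hfd : ∀ y h, fderiv ℝ ψ y h =
      inner ℝ p h + 1 / 2 * (inner ℝ (M (y - x₀)) h + inner ℝ (M h) (y - x₀)) := by
    intro y h
    have h1 := ((((hasFDerivAt_const p y).inner ℝ (hid y)).const_add b).add
      (((hM y).inner ℝ (hid y)).const_mul (1 / 2)))
    have h2 : fderiv ℝ ψ y = _ := h1.fderiv
    rw [h2]
    simp [fderivInnerCLM_apply]
  ext i j
  simp only [hessMatrix, quadMat, Matrix.of_apply, iteratedFDeriv_two_apply]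
  set u : EucSp n := EuclideanSpace.single i 1
  set w : EucSp n := EuclideanSpace.single j 1
  have hd : DifferentiableAt ℝ (fderiv ℝ ψ) x₀ :=
    ((hC.fderiv_right (m := 1) (by norm_num)).differentiable (by norm_num)) x₀
  have h3 : HasFDerivAt (fun y => fderiv ℝ ψ y w)
      ((ContinuousLinearMap.apply ℝ ℝ w).comp (fderiv ℝ (fderiv ℝ ψ) x₀)) x₀ :=
    (ContinuousLinearMap.apply ℝ ℝ w).hasFDerivAt.comp x₀ hd.hasFDerivAt
  rw [show (fun y => fderiv ℝ ψ y w) = fun y =>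
    inner ℝ p w + 1 / 2 * (inner ℝ (M (y - x₀)) w + inner ℝ (M w) (y - x₀)) from
    funext fun y => hfd y w] at h3
  have h4 := ((((hM x₀).inner ℝ (hasFDerivAt_const w x₀)).add
    ((hasFDerivAt_const (M w) x₀).inner ℝ (hid x₀))).const_mul (1 / 2)).const_add (inner ℝ p w)
  have h5 := congrArg (fun L => L u) (h3.unique h4)
  simp [fderivInnerCLM_apply] at h5
  simp only [Matrix.cons_val_zero, Matrix.cons_val_one]
  rw [h5]
  ring

/-- Membership form of the viscosity condition for quadratic test functions. -/
lemma FSubharmonicOn.quadMat_mem {S : Set (SymMat n)} {X : Set (EucSp n)} {u : EucSp n → EReal}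
    (hu : FSubharmonicOn S X u) {x₀ : EucSp n} (hx : x₀ ∈ X) {b : ℝ} {p : EucSp n}
    {M : EucSp n →L[ℝ] EucSp n} (hb : u x₀ = b)
    (hle : ∀ᶠ y in 𝓝 x₀, u y ≤
      ((b + inner ℝ p (y - x₀) + 1 / 2 * inner ℝ (M (y - x₀)) (y - x₀) : ℝ) : EReal)) :
    quadMat M ∈ S := by
  obtain ⟨h1, h2⟩ := hessMatrix_quadratic_s7 b p M x₀
  obtain ⟨A, hA, hAe⟩ := hu.2.2 x₀ hx _
    ⟨h1.contDiffAt, hle.filter_mono nhdsWithin_le_nhds, by simpa using hb⟩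
  rw [h2] at hAe
  rwa [← Subtype.ext hAe]

lemma upperSemicontinuousOn_const_mul {α : Type*} [TopologicalSpace α] {u : α → EReal}
    {X : Set α} (hu : UpperSemicontinuousOn u X) {a : ℝ} (ha : 0 < a) :
    UpperSemicontinuousOn (fun y => (a : EReal) * u y) X := by
  have hc : Continuous fun z : EReal => (a : EReal) * z :=
    have ha0 : (a : EReal) ≠ 0 := by exact_mod_cast ha.ne'
    continuous_iff_continuousAt.2 fun z =>
      (EReal.continuousAt_mul (p := ((a : EReal), z)) (Or.inl ha0) (Or.inl ha0) (Or.inl (EReal.coe_ne_bot a))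
        (Or.inl (EReal.coe_ne_top a))).comp (f := fun z : EReal => ((a : EReal), z))
        (by fun_prop)
  exact hc.comp_upperSemicontinuousOn hu fun p q hpq =>
    mul_le_mul_of_nonneg_left hpq (by exact_mod_cast ha.le)

lemma FSubharmonicOn.const_mul {F : ConeSubequation n} {X : Set (EucSp n)} {u : EucSp n → EReal}
    (hu : FSubharmonicOn F.carrier X u) {a : ℝ} (ha : 0 < a) :
    FSubharmonicOn F.carrier X fun y => (a : EReal) * u y := by
  have ha0 : (0 : EReal) ≤ ((a⁻¹ : ℝ) : EReal) := by exact_mod_cast (inv_pos.2 ha).le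
  have hinv : ∀ z : EReal, ((a⁻¹ : ℝ) : EReal) * ((a : EReal) * z) = z := fun z => by
    rw [← mul_assoc, ← EReal.coe_mul, inv_mul_cancel₀ ha.ne', EReal.coe_one, one_mul]
  refine ⟨upperSemicontinuousOn_const_mul hu.1 ha, fun y hy h => hu.2.1 y hy ?_, ?_⟩
  · replace h : (a : EReal) * u y = ⊤ := h
    rw [← hinv (u y), h, EReal.coe_mul_top_of_pos (inv_pos.2 ha)]
  · rintro x₀ hx₀ ψ ⟨hC, hle, heq⟩
    replace heq : (a : EReal) * u x₀ = ψ x₀ := heq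
    obtain ⟨A, hA, hAe⟩ := hu.2.2 x₀ hx₀ (a⁻¹ • ψ) ⟨contDiffAt_const.smul hC, hle.mono fun y hy => by
        rw [← hinv (u y)]
        simpa using mul_le_mul_of_nonneg_left hy ha0, by
        rw [← hinv (u x₀), heq]
        simp⟩
    refine ⟨a • A, F.f2 A hA a ha, ?_⟩
    ext i j
    have h1 := congrFun (congrFun hAe i) j
    simp only [hessMatrix, Matrix.of_apply, iteratedFDeriv_const_smul_apply (i := 2) hC] at h1
    simp only [selfAdjoint.val_smul, Matrix.smul_apply, hessMatrix, Matrix.of_apply, h1]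
    simp [ha.ne']

lemma exists_real_upper_bound {α : Type*} [TopologicalSpace α] {u : α → EReal} {K : Set α}
    (hK : IsCompact K) (hu : UpperSemicontinuousOn u K) (htop : ∀ y ∈ K, u y ≠ ⊤) :
    ∃ M : ℝ, 0 ≤ M ∧ ∀ y ∈ K, u y ≤ M := by
  rcases K.eq_empty_or_nonempty with rfl | hne
  · exact ⟨0, le_rfl, by simp⟩
  · obtain ⟨a, ha, hmax⟩ := hu.exists_isMaxOn hne hK
    refine ⟨max (u a).toReal 0, le_max_right _ _, fun y hy => (hmax hy).trans ?_⟩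
    exact (EReal.le_coe_toReal (htop a ha)).trans (EReal.coe_le_coe_iff.2 (le_max_left _ _))

/-- The part at height at least `m` of the hypograph over `K` of `u + θ`. -/
def truncHypograph (K : Set (EucSp n)) (u : EucSp n → EReal) (θ : EucSp n → ℝ) (m : ℝ) :
    Set (EucSp n × ℝ) :=
  {q | q.1 ∈ K ∧ m ≤ q.2 ∧ ((q.2 - θ q.1 : ℝ) : EReal) ≤ u q.1}

lemma exists_height_bound {K : Set (EucSp n)} (hK : IsCompact K) {u : EucSp n → EReal}
    (hu : UpperSemicontinuousOn u K) (htop : ∀ y ∈ K, u y ≠ ⊤) {θ : EucSp n → ℝ}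
    (hθ : Continuous θ) :
    ∃ B : ℝ, ∀ y ∈ K, ∀ t : ℝ, ((t - θ y : ℝ) : EReal) ≤ u y → t ≤ B := by
  obtain ⟨M, -, hM⟩ := exists_real_upper_bound hK hu htop
  obtain ⟨T, hT⟩ := hK.bddAbove_image hθ.continuousOn
  refine ⟨M + T, fun y hy t ht => ?_⟩
  have h1 := EReal.coe_le_coe_iff.1 (ht.trans (hM y hy))
  have h2 := hT (Set.mem_image_of_mem θ hy)
  linarith

lemma isCompact_truncHypograph {K : Set (EucSp n)} (hK : IsCompact K) {u : EucSp n → EReal}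
    (hu : UpperSemicontinuousOn u K) (htop : ∀ y ∈ K, u y ≠ ⊤) {θ : EucSp n → ℝ}
    (hθ : Continuous θ) (m : ℝ) : IsCompact (truncHypograph K u θ m) := by
  obtain ⟨B, hB⟩ := exists_height_bound hK hu htop hθ
  refine (hK.prod (isCompact_Icc (a := m) (b := B))).of_isClosed_subset ?_
    fun q hq => ⟨hq.1, hq.2.1, hB _ hq.1 _ hq.2.2⟩
  have h1 := (upperSemicontinuousOn_iff_isClosed_hypograph hK.isClosed).1 hu
  have h2 : Continuous fun q : EucSp n × ℝ => (q.1, ((q.2 - θ q.1 : ℝ) : EReal)) :=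
    continuous_fst.prodMk (continuous_coe_real_ereal.comp
      (continuous_snd.sub (hθ.comp continuous_fst)))
  have h3 : truncHypograph K u θ m =
      (fun q : EucSp n × ℝ => (q.1, ((q.2 - θ q.1 : ℝ) : EReal))) ⁻¹'
        {q | q.1 ∈ K ∧ q.2 ≤ u q.1} ∩ {q | m ≤ q.2} := by
    ext q
    simp only [truncHypograph, Set.mem_inter_iff, Set.mem_preimage, Set.mem_ofPred_eq]
    tauto
  rw [h3]
  exact (h1.preimage h2).inter (isClosed_le continuous_const continuous_snd)

/-- A quadratic contact from above of the truncated hypograph of `u + θ`, for a quadratic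
perturbation `θ`, produces an element of the subequation. -/
lemma FSubharmonicOn.quadMat_mem_of_contact {S : Set (SymMat n)} {X K : Set (EucSp n)}
    {u : EucSp n → EReal} (hu : FSubharmonicOn S X u) {x₀ a : EucSp n} {c m : ℝ}
    {y p : EucSp n} {t η : ℝ} {L : EucSp n →L[ℝ] EucSp n} (hy : y ∈ X) (hKy : K ∈ 𝓝 y)
    (hmem : (y, t) ∈ truncHypograph K u
      (fun z => inner ℝ a (z - x₀) + c * ‖z - x₀‖ ^ 2) m) (hm : m < t)
    (hcontact : ∀ᶠ h in 𝓝 (0 : EucSp n), ∀ t', (y + h, t') ∈ truncHypograph K u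
      (fun z => inner ℝ a (z - x₀) + c * ‖z - x₀‖ ^ 2) m →
      t' ≤ t + inner ℝ p h + 1 / 2 * inner ℝ (L h) h + η * ‖h‖ ^ 2) :
    quadMat (L + (2 * η - 2 * c) • ContinuousLinearMap.id ℝ (EucSp n)) ∈ S := by
  set θ : EucSp n → ℝ := fun z => inner ℝ a (z - x₀) + c * ‖z - x₀‖ ^ 2 with hθ
  have hexp : ∀ h, θ (y + h) = θ y + inner ℝ (a + (2 * c) • (y - x₀)) h + c * ‖h‖ ^ 2 := by
    intro h
    have h1 : y + h - x₀ = (y - x₀) + h := by abel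
    simp only [hθ, h1, inner_add_right, norm_add_sq_real, inner_add_left, inner_smul_left,
      RCLike.conj_to_real]
    ring
  have hlt : ∀ z, z ∈ K → ∀ b : ℝ, m ≤ b + θ z → (b : EReal) < u z →
      ∃ t', b + θ z < t' ∧ (z, t') ∈ truncHypograph K u θ m := by
    intro z hz b hb hlt
    obtain ⟨b', h1, h2⟩ := EReal.lt_iff_exists_real_btwn.1 hlt
    have h1' := EReal.coe_lt_coe_iff.1 h1
    exact ⟨b' + θ z, by linarith, hz, by simp only; linarith, by simpa using h2.le⟩
  have hself : u y = ((t - θ y : ℝ) : EReal) := by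
    refine le_antisymm (le_of_not_gt fun hgt => ?_) hmem.2.2
    obtain ⟨t', h1, h2⟩ := hlt y hmem.1 _ (by linarith) hgt
    have h3 := hcontact.self_of_nhds t' (by simpa using h2)
    simp at h3
    linarith
  refine hu.quadMat_mem hy (p := p - (a + (2 * c) • (y - x₀))) hself ?_
  have htend : Tendsto (fun z => z - y) (𝓝 y) (𝓝 0) := by
    have : Tendsto (fun z => z - y) (𝓝 y) (𝓝 (y - y)) := tendsto_id.sub_const y
    simpa using this
  have hcont : Tendsto (fun h : EucSp n => t + inner ℝ p h + 1 / 2 * inner ℝ (L h) h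
      + η * ‖h‖ ^ 2) (𝓝 0) (𝓝 t) := by
    have : Continuous fun h : EucSp n => t + inner ℝ p h + 1 / 2 * inner ℝ (L h) h
      + η * ‖h‖ ^ 2 := by fun_prop
    simpa using this.tendsto 0
  filter_upwards [htend.eventually hcontact, htend.eventually (hcont.eventually (lt_mem_nhds hm)),
    hKy] with z h1 h2 hz
  refine le_of_not_gt fun hgt => ?_
  have hyz : y + (z - y) = z := by abel
  have h4 := hexp (z - y)
  rw [hyz] at h1 h4
  have h5 : inner ℝ ((L + (2 * η - 2 * c) • ContinuousLinearMap.id ℝ (EucSp n)) (z - y)) (z - y)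
      = inner ℝ (L (z - y)) (z - y) + (2 * η - 2 * c) * ‖z - y‖ ^ 2 := by
    simp [inner_add_left, inner_smul_left]
  rw [h5, inner_sub_left] at hgt
  obtain ⟨t', h6, h7⟩ := hlt z hz _ (by linarith) hgt
  have h8 := h1 t' h7
  linarith

/-- The sum of a subharmonic and a dually subharmonic function has no strict quadratic
maximum. -/
theorem no_strict_quadratic_maximum (F : ConeSubequation n) {X : Set (EucSp n)}
    {v w : EucSp n → EReal} (hv : FSubharmonicOn F.carrier X v)
    (hw : FSubharmonicOn (dualSet F.carrier) X w) {x₀ a : EucSp n} {r c t₀ s₀ : ℝ} (hr : 0 < r)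
    (hX : Metric.closedBall x₀ r ⊆ X) (hc : 0 < c) (hvx : v x₀ = t₀) (hwx : w x₀ = s₀)
    (hle : ∀ y ∈ Metric.closedBall x₀ r,
      v y + w y + ((inner ℝ a (y - x₀) + 2 * c * ‖y - x₀‖ ^ 2 : ℝ) : EReal) ≤
        ((t₀ + s₀ : ℝ) : EReal)) : False := by
  set K := Metric.closedBall x₀ r with hKdef
  have hK : IsCompact K := isCompact_closedBall x₀ r
  have hx₀ : x₀ ∈ K := Metric.mem_closedBall_self hr.le
  have hvK : UpperSemicontinuousOn v K := hv.1.mono hX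
  have hwK : UpperSemicontinuousOn w K := hw.1.mono hX
  have hvT : ∀ y ∈ K, v y ≠ ⊤ := fun y hy => hv.2.1 y (hX hy)
  have hwT : ∀ y ∈ K, w y ≠ ⊤ := fun y hy => hw.2.1 y (hX hy)
  set θ : EucSp n → ℝ := fun z => inner ℝ a (z - x₀) + c * ‖z - x₀‖ ^ 2 with hθ
  set θ' : EucSp n → ℝ := fun z => inner ℝ (0 : EucSp n) (z - x₀) + 0 * ‖z - x₀‖ ^ 2 with hθ'
  have hθc : Continuous θ := by fun_prop
  have hθc' : Continuous θ' := by fun_prop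
  have hθ0 : ∀ z, θ' z = 0 := fun z => by simp [hθ']
  have hθx : θ x₀ = 0 := by simp [hθ]
  obtain ⟨B₁, hB₁⟩ := exists_height_bound hK hvK hvT hθc
  obtain ⟨B₂, hB₂⟩ := exists_height_bound hK hwK hwT hθc'
  have ht₀ : t₀ ≤ B₁ := hB₁ x₀ hx₀ t₀ (by rw [hθx, sub_zero, hvx])
  have hs₀ : s₀ ≤ B₂ := hB₂ x₀ hx₀ s₀ (by rw [hθ0, sub_zero, hwx])
  set m := t₀ + s₀ - 1 - max B₁ B₂ with hmdef
  have hm₁ := le_max_left B₁ B₂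
  have hm₂ := le_max_right B₁ B₂
  have hsum : ∀ y t s, (y, t) ∈ truncHypograph K v θ m → (y, s) ∈ truncHypograph K w θ' m →
      t + s ≤ t₀ + s₀ - c * ‖y - x₀‖ ^ 2 := by
    rintro y t s ⟨hy, -, h1⟩ ⟨-, -, h2⟩
    simp only [hθ0, sub_zero] at h1 h2
    have h3 := (add_le_add_left (add_le_add h1 h2)
      ((inner ℝ a (y - x₀) + 2 * c * ‖y - x₀‖ ^ 2 : ℝ) : EReal)).trans (hle y hy)
    have h4 : t - θ y + s + (inner ℝ a (y - x₀) + 2 * c * ‖y - x₀‖ ^ 2) ≤ t₀ + s₀ := by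
      exact_mod_cast h3
    simp only [hθ] at h4
    linarith
  set η := min (min r 1) (c / 8) with hη
  have hη0 : 0 < η := by positivity
  have hηr : η ≤ r := (min_le_left _ _).trans (min_le_left _ _)
  have hη1 : η ≤ 1 := (min_le_left _ _).trans (min_le_right _ _)
  have hηc : η ≤ c / 8 := min_le_right _ _
  obtain ⟨y, t, z, s, p₁, p₂, L₁, L₂, hyt, hzs, hyη, hzη, hts, hc₁, hc₂, hL⟩ :=
    exists_quadratic_contacts (isCompact_truncHypograph hK hvK hvT hθc m)
      (isCompact_truncHypograph hK hwK hwT hθc' m) (x₀ := x₀) (t₀ := t₀) (s₀ := s₀)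
      ⟨hx₀, by simp only; linarith, by simp only [hθx, sub_zero, hvx]; exact le_rfl⟩
      ⟨hx₀, by simp only; linarith, by simp only [hθ0, sub_zero, hwx]; exact le_rfl⟩
      (fun y t s h1 h2 => (hsum y t s h1 h2).trans (by
        have : 0 ≤ c * ‖y - x₀‖ ^ 2 := by positivity
        linarith))
      (fun y t s h1 h2 h3 => by
        have h4 := hsum y t s h1 h2
        by_contra hne
        have h5 : 0 < ‖y - x₀‖ := norm_pos_iff.2 (sub_ne_zero.2 hne)
        have : 0 < c * ‖y - x₀‖ ^ 2 := by positivity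
        linarith) hη0
  have hnhds : ∀ y, ‖y - x₀‖ < η → K ∈ 𝓝 y := fun y hy =>
    Metric.closedBall_mem_nhds_of_mem (by rw [Metric.mem_ball, dist_eq_norm]; linarith)
  have htB := hB₁ y hyt.1 t hyt.2.2
  have hsB := hB₂ z hzs.1 s hzs.2.2
  have hA₁ := hv.quadMat_mem_of_contact (hX hyt.1) (hnhds y hyη) hyt (by linarith) hc₁
  have hA₂ := hw.quadMat_mem_of_contact (hX hzs.1) (hnhds z hzη) hzs (by linarith) hc₂
  refine hA₂ ?_
  have hint := add_quadMat_mem_interior F hA₁ (κ := c) hc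
    (M := -(L₂ + (2 * η - 2 * 0) • ContinuousLinearMap.id ℝ (EucSp n)) -
      (L₁ + (2 * η - 2 * c) • ContinuousLinearMap.id ℝ (EucSp n))) fun h => by
      have h1 := hL h
      have h2 : η * ‖h‖ ^ 2 ≤ c / 8 * ‖h‖ ^ 2 := by gcongr
      simp only [sub_apply, neg_apply, add_apply, smul_apply, ContinuousLinearMap.id_apply,
        inner_sub_left, inner_neg_left, inner_add_left, inner_smul_left, RCLike.conj_to_real,
        real_inner_self_eq_norm_sq]
      linarith
  rw [← quadMat_add] at hint
  rw [← quadMat_neg]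
  convert hint using 2
  abel

lemma exists_real_of_lt_div {z : EReal} (hz : z ≠ ⊤) {t d q : ℝ} (hd : 0 < d)
    (h : (q : EReal) < (z - t) / (d : EReal)) : ∃ p : ℝ, z = p ∧ q * d < p - t := by
  induction z with
  | bot =>
    rw [EReal.bot_sub, EReal.bot_div_of_pos_ne_top (by exact_mod_cast hd)
      (EReal.coe_ne_top d)] at h
    exact absurd h not_lt_bot
  | top => exact absurd rfl hz
  | coe p =>
    refine ⟨p, rfl, ?_⟩
    rw [← EReal.coe_sub, ← EReal.coe_div, EReal.coe_lt_coe_iff, lt_div_iff₀ hd] at h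
    exact h

lemma DPSingular.false_of_perturbed_maximum {F : ConeSubequation n} {U : Set (EucSp n)}
    {x₀ : EucSp n} {h v w : EucSp n → EReal} (hh : DPSingular F U x₀ h) (hfin : h x₀ ≠ ⊥)
    (hv1 : (1 : EReal) ≤ liminf (fun y => (v y - v x₀) / (h y - h x₀)) (𝓝[≠] x₀))
    (hw1 : (-1 : EReal) ≤ liminf (fun y => (w y - w x₀) / (h y - h x₀)) (𝓝[≠] x₀))
    {t s δ C : ℝ} (hvx : v x₀ = t) (hwx : w x₀ = s) (hδ : 0 < δ) (hδ1 : δ ≤ 1)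
    (hvtop : ∀ᶠ y in 𝓝 x₀, v y ≠ ⊤) (hwtop : ∀ᶠ y in 𝓝 x₀, w y ≠ ⊤)
    (hmax : ∀ᶠ y in 𝓝 x₀, ((1 + δ : ℝ) : EReal) * v y + w y + ((C * ‖y‖ ^ 2 : ℝ) : EReal) ≤
      (((1 + δ) * t + s + C * ‖x₀‖ ^ 2 : ℝ) : EReal)) : False := by
  have hnt := hh.polarOrFinite.resolve_left hfin
  have htop := hh.subh.2.1
  obtain ⟨b₀, hb₀⟩ : ∃ b₀ : ℝ, h x₀ = b₀ := ⟨_, (EReal.coe_toReal (htop x₀ hh.mem) hfin).symm⟩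
  have hv2 := eventually_lt_of_lt_liminf (lt_of_lt_of_le
    (show ((1 - δ / 4 : ℝ) : EReal) < 1 by
      rw [← EReal.coe_one, EReal.coe_lt_coe_iff]; linarith) hv1)
  have hw2 := eventually_lt_of_lt_liminf (lt_of_lt_of_le
    (show ((-1 - δ / 4 : ℝ) : EReal) < -1 by
      rw [← EReal.coe_one, ← EReal.coe_neg, EReal.coe_lt_coe_iff]; linarith) hw1)
  rw [eventually_nhdsWithin_iff] at hv2 hw2
  refine hnt.2 (fun y => b₀ + 4 / δ * (C * (‖x₀‖ ^ 2 - ‖y‖ ^ 2))) ⟨?_, ?_, by simpa using hb₀⟩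
  · exact (contDiff_const.add (contDiff_const.mul (contDiff_const.mul
      (contDiff_const.sub (contDiff_norm_sq ℝ))))).contDiffAt
  · refine Eventually.filter_mono nhdsWithin_le_nhds ?_
    filter_upwards [hv2, hw2, hvtop, hwtop, hmax, hh.isOpen'.mem_nhds hh.mem]
      with y hvy hwy hvt hwt hm hyU
    by_cases hy : y = x₀
    · subst hy
      simp [hb₀]
    have hlt := hh.strictMin y hyU hy
    obtain ⟨b, hb⟩ : ∃ b : ℝ, h y = b :=
      ⟨_, (EReal.coe_toReal (htop y hyU) (ne_bot_of_gt hlt)).symm⟩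
    rw [hb, hb₀, EReal.coe_lt_coe_iff] at hlt
    replace hvy := hvy hy
    replace hwy := hwy hy
    rw [hb, hb₀, ← EReal.coe_sub] at hvy hwy
    rw [hvx] at hvy
    rw [hwx] at hwy
    obtain ⟨p, hp, hp'⟩ := exists_real_of_lt_div hvt (sub_pos.2 hlt) hvy
    obtain ⟨q, hq, hq'⟩ := exists_real_of_lt_div hwt (sub_pos.2 hlt) hwy
    rw [hp, hq] at hm
    have hm' : (1 + δ) * p + q + C * ‖y‖ ^ 2 ≤ (1 + δ) * t + s + C * ‖x₀‖ ^ 2 := by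
      exact_mod_cast hm
    rw [hb, EReal.coe_le_coe_iff]
    have h1 : (1 + δ) * ((1 - δ / 4) * (b - b₀)) ≤ (1 + δ) * (p - t) := by gcongr
    have h2 : δ / 4 * (b - b₀) ≤ (δ / 2 - δ ^ 2 / 4) * (b - b₀) := by
      apply mul_le_mul_of_nonneg_right _ (sub_pos.2 hlt).le
      nlinarith
    have h3 : δ / 4 * (b - b₀) ≤ C * (‖x₀‖ ^ 2 - ‖y‖ ^ 2) := by linarith
    have h4 : b - b₀ = 4 / δ * (δ / 4 * (b - b₀)) := by field_simp
    have h5 : 4 / δ * (δ / 4 * (b - b₀)) ≤ 4 / δ * (C * (‖x₀‖ ^ 2 - ‖y‖ ^ 2)) := by gcongr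
    linarith

lemma add_coe_le_of_add_coe_add_le {e : EReal} {q k T : ℝ}
    (h : e + ((q + k : ℝ) : EReal) ≤ ((T + k : ℝ) : EReal)) : e + (q : EReal) ≤ T := by
  induction e with
  | bot => simp
  | top =>
    rw [EReal.top_add_coe, top_le_iff] at h
    exact absurd h (EReal.coe_ne_top _)
  | coe p =>
    rw [← EReal.coe_add, EReal.coe_le_coe_iff] at h ⊢
    linarith

/-- Comparison for singular data, on the whole closure of the domain. -/
lemma add_nonpos_of_liminf_quotient_ge {k : ℕ} (F : ConeSubequation n)
    (Ω : Set (EucSp n)) (hΩ : IsBoundedDomain Ω)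
    (x : Fin k → EucSp n)
    (U : Fin k → Set (EucSp n)) (h : Fin k → EucSp n → EReal)
    (hh : ∀ j, DPSingular F (U j) (x j) (h j)) (hfin : ∀ j, h j (x j) ≠ ⊥)
    (v w : EucSp n → EReal)
    (hvusc : UpperSemicontinuousOn v (closure Ω))
    (hwusc : UpperSemicontinuousOn w (closure Ω))
    (hvtop : ∀ y ∈ closure Ω, v y ≠ ⊤) (hwtop : ∀ y ∈ closure Ω, w y ≠ ⊤)
    (hv : FSubharmonicOn F.carrier (Ω \ Set.range x) v)
    (hw : FSubharmonicOn (dualSet F.carrier) (Ω \ Set.range x) w)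
    (hv1 : ∀ j, (1 : EReal) ≤
      liminf (fun y => (v y - v (x j)) / (h j y - h j (x j))) (𝓝[≠] x j))
    (hw1 : ∀ j, (-1 : EReal) ≤
      liminf (fun y => (w y - w (x j)) / (h j y - h j (x j))) (𝓝[≠] x j))
    (hbdry : ∀ y ∈ frontier Ω, v y + w y ≤ 0) :
    ∀ y ∈ closure Ω, v y + w y ≤ 0 := by
  intro y₀ hy₀
  by_contra hpos
  rw [not_le] at hpos
  obtain ⟨a₀, ha₀⟩ : ∃ a₀ : ℝ, v y₀ = a₀ := ⟨_, (EReal.coe_toReal (hvtop y₀ hy₀) fun hb => by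
    simp [hb] at hpos).symm⟩
  obtain ⟨b₀, hb₀⟩ : ∃ b₀ : ℝ, w y₀ = b₀ := ⟨_, (EReal.coe_toReal (hwtop y₀ hy₀) fun hb => by
    simp [hb] at hpos).symm⟩
  rw [ha₀, hb₀] at hpos
  replace hpos : 0 < a₀ + b₀ := by exact_mod_cast hpos
  have hK : IsCompact (closure Ω) := hΩ.2.2.isCompact_closure
  obtain ⟨M, hM0, hM⟩ := exists_real_upper_bound hK hvusc hvtop
  obtain ⟨R, hR⟩ := hK.bddAbove_image (f := fun y => ‖y‖ ^ 2) (by fun_prop)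
  replace hR : ∀ y ∈ closure Ω, ‖y‖ ^ 2 ≤ R := fun y hy => hR (Set.mem_image_of_mem _ hy)
  have hR0 : 0 ≤ R := (by positivity : 0 ≤ ‖y₀‖ ^ 2).trans (hR y₀ hy₀)
  obtain ⟨δ, hδ, hδ1, hδM⟩ : ∃ δ : ℝ, 0 < δ ∧ δ ≤ 1 ∧ δ * (M + |a₀|) ≤ (a₀ + b₀) / 2 := by
    refine ⟨min 1 ((a₀ + b₀) / 2 / (M + |a₀| + 1)), by positivity, min_le_left _ _, ?_⟩
    calc _ ≤ (a₀ + b₀) / 2 / (M + |a₀| + 1) * (M + |a₀| + 1) := by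
          gcongr ?_ * ?_
          · exact min_le_right _ _
          · linarith
      _ = _ := by field_simp
  obtain ⟨c, hc, hcR⟩ : ∃ c : ℝ, 0 < c ∧ 2 * c * R < (a₀ + b₀) / 2 := by
    refine ⟨(a₀ + b₀) / 4 / (R + 1), by positivity, ?_⟩
    rw [show 2 * ((a₀ + b₀) / 4 / (R + 1)) * R = (a₀ + b₀) / 2 * (R / (R + 1)) by
      field_simp; norm_num]
    have : R / (R + 1) < 1 := by rw [div_lt_one (by linarith)]; linarith
    nlinarith
  have hδ' : 0 < 1 + δ := by linarith
  set V : EucSp n → EReal := fun y => ((1 + δ : ℝ) : EReal) * v y with hV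
  have hVtop : ∀ y ∈ closure Ω, V y ≠ ⊤ := fun y hy => by
    have := hvtop y hy
    simp only [hV]
    induction hz : v y with
    | bot => rw [EReal.coe_mul_bot_of_pos hδ']; exact bot_ne_top
    | top => exact absurd hz this
    | coe p => rw [← EReal.coe_mul]; exact EReal.coe_ne_top _
  have husc : UpperSemicontinuousOn
      (fun y => V y + w y + ((2 * c * ‖y‖ ^ 2 : ℝ) : EReal)) (closure Ω) := by
    refine ((upperSemicontinuousOn_const_mul hvusc hδ').add' hwusc fun y hy =>
      EReal.continuousAt_add (Or.inl (hVtop y hy)) (Or.inr (hwtop y hy))).add' ?_ fun y hy =>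
      EReal.continuousAt_add (Or.inr (EReal.coe_ne_bot _)) (Or.inr (EReal.coe_ne_top _))
    have : Continuous fun y : EucSp n => ((2 * c * ‖y‖ ^ 2 : ℝ) : EReal) :=
      continuous_coe_real_ereal.comp (by fun_prop)
    exact this.upperSemicontinuous.upperSemicontinuousOn _
  obtain ⟨z, hz, hmax⟩ := husc.exists_isMaxOn ⟨y₀, hy₀⟩ hK
  have hbig : ((δ * M + 2 * c * R : ℝ) : EReal) < V z + w z + ((2 * c * ‖z‖ ^ 2 : ℝ) : EReal) := by
    refine lt_of_lt_of_le ?_ (hmax hy₀)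
    simp only [hV, ha₀, hb₀]
    rw [← EReal.coe_mul, ← EReal.coe_add, ← EReal.coe_add, EReal.coe_lt_coe_iff]
    have h1 : 0 ≤ 2 * c * ‖y₀‖ ^ 2 := by positivity
    have h2 : δ * (-a₀) ≤ δ * |a₀| := by gcongr; exact neg_le_abs a₀
    linarith
  obtain ⟨t, ht⟩ : ∃ t : ℝ, v z = t := ⟨_, (EReal.coe_toReal (hvtop z hz) fun hb => by
    simp only [hV, hb, EReal.coe_mul_bot_of_pos hδ', EReal.bot_add, not_lt_bot] at hbig).symm⟩
  obtain ⟨s, hs⟩ : ∃ s : ℝ, w z = s := ⟨_, (EReal.coe_toReal (hwtop z hz) fun hb => by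
    simp [hb] at hbig).symm⟩
  have hUz : V z + w z + ((2 * c * ‖z‖ ^ 2 : ℝ) : EReal) =
      (((1 + δ) * t + s + 2 * c * ‖z‖ ^ 2 : ℝ) : EReal) := by
    simp only [hV, ht, hs, EReal.coe_add, EReal.coe_mul]
  have hmax' : ∀ y ∈ closure Ω, V y + w y + ((2 * c * ‖y‖ ^ 2 : ℝ) : EReal) ≤
      (((1 + δ) * t + s + 2 * c * ‖z‖ ^ 2 : ℝ) : EReal) := fun y hy => hUz ▸ hmax hy
  rw [hUz, EReal.coe_lt_coe_iff] at hbig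
  have hzΩ : z ∈ Ω := by
    by_contra hzn
    have h1 := hbdry z ⟨hz, fun hi => hzn (interior_subset hi)⟩
    rw [ht, hs] at h1
    replace h1 : t + s ≤ 0 := by exact_mod_cast h1
    have h2 : t ≤ M := by
      have := hM z hz
      rwa [ht, EReal.coe_le_coe_iff] at this
    have h3 : 2 * c * ‖z‖ ^ 2 ≤ 2 * c * R := by gcongr; exact hR z hz
    nlinarith
  by_cases hzx : z ∈ Set.range x
  · obtain ⟨j, rfl⟩ := hzx
    have hΩn := hΩ.1.mem_nhds hzΩ
    exact (hh j).false_of_perturbed_maximum (hfin j) (hv1 j) (hw1 j) ht hs hδ hδ1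
      (by filter_upwards [hΩn] with y hy using hvtop y (subset_closure hy))
      (by filter_upwards [hΩn] with y hy using hwtop y (subset_closure hy))
      (by filter_upwards [hΩn] with y hy using hmax' y (subset_closure hy))
  · have hopen : IsOpen (Ω \ Set.range x) := hΩ.1.sdiff (Set.finite_range x).isClosed
    obtain ⟨r, hr, hball⟩ := Metric.nhds_basis_closedBall.mem_iff.1 (hopen.mem_nhds ⟨hzΩ, hzx⟩)
    refine no_strict_quadratic_maximum F (hv.const_mul hδ') hw (a := (4 * c) • z) (c := c)
      (t₀ := (1 + δ) * t) (s₀ := s) hr hball hc (by simp [ht]) hs fun y hy => ?_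
    have h1 := hmax' y (subset_closure (hball hy).1)
    apply add_coe_le_of_add_coe_add_le (k := 2 * c * ‖z‖ ^ 2)
    convert h1 using 3
    have h2 := norm_add_sq_real z (y - z)
    rw [add_sub_cancel] at h2
    rw [h2, inner_smul_left, RCLike.conj_to_real]
    ring

/-- Comparison in the finite case, Theorem 5.4. -/
theorem dirichlet_singularities_stmt7 {n k : ℕ} (F : ConeSubequation n)
    (Ω : Set (EucSp n)) (hΩ : IsBoundedDomain Ω)
    (x : Fin k → EucSp n) (hx : ∀ j, x j ∈ Ω)
    (U : Fin k → Set (EucSp n)) (h : Fin k → EucSp n → EReal)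
    (hh : ∀ j, DPSingular F (U j) (x j) (h j)) (hfin : ∀ j, h j (x j) ≠ ⊥)
    (v w : EucSp n → EReal)
    (hvusc : UpperSemicontinuousOn v (closure Ω))
    (hwusc : UpperSemicontinuousOn w (closure Ω))
    (hvtop : ∀ y ∈ closure Ω, v y ≠ ⊤) (hwtop : ∀ y ∈ closure Ω, w y ≠ ⊤)
    (hv : FSubharmonicOn F.carrier (Ω \ Set.range x) v)
    (hw : FSubharmonicOn (dualSet F.carrier) (Ω \ Set.range x) w)
    (hv1 : ∀ j, (1 : EReal) ≤
      Filter.liminf (fun y => (v y - v (x j)) / (h j y - h j (x j))) (𝓝[≠] x j))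
    (hw1 : ∀ j, (-1 : EReal) ≤
      Filter.liminf (fun y => (w y - w (x j)) / (h j y - h j (x j))) (𝓝[≠] x j))
    (hbdry : ∀ y ∈ frontier Ω, v y + w y ≤ 0) :
    (∀ y ∈ closure Ω \ Set.range x, v y + w y ≤ 0) ∧
    (∀ j, Filter.limsup (fun y => v y + w y) (𝓝[≠] x j) ≤ 0) := by
  have hmain := add_nonpos_of_liminf_quotient_ge F Ω hΩ x U h hh hfin v w hvusc hwusc hvtop hwtop hv hw
    hv1 hw1 hbdry
  refine ⟨fun y hy => hmain y hy.1, fun j => limsup_le_of_le (by isBoundedDefault) ?_⟩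
  filter_upwards [mem_nhdsWithin_of_mem_nhds (hΩ.1.mem_nhds (hx j))] with y hy
  exact hmain y (subset_closure hy)
end
end
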